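/- Let G_n = Z_n^3 be the 3-dimensional discrete torus. For each c > 1, the limit lim_{n→∞} (1/n^4) Σ_{x,y ∈ V_n} (f_{n,c}(x,y) − f̄_{n,c})^2 exists and is positive and finite. -/

import Mathlib

open MeasureTheory ProbabilityTheory Filter

attribute [local instance] Classical.propDecidable

noncomputable section

namespace RWPaint

variable {V : Type*} [Fintype V]

/-- The degree of a vertex. -/
def deg (G : SimpleGraph V) (x : V) : ℕ := (Finset.univ.filter fun y => G.Adj x y).card

/-- One-step transition kernel of the lazy random walk on a finite graph:
holding probability `1/2`, otherwise a uniformly chosen neighbour. -/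
def K (G : SimpleGraph V) (x y : V) : ℝ :=
  if x = y then (if deg G x = 0 then 1 else 1 / 2)
  else if G.Adj x y then 1 / (2 * (deg G x : ℝ)) else 0

/-- The `t`-step transition kernel. -/
def Kpow (G : SimpleGraph V) : ℕ → V → V → ℝ
  | 0 => fun x y => if x = y then 1 else 0
  | t + 1 => fun x y => ∑ z, Kpow G t x z * K G z y

/-- The uniform (stationary) probability of a single vertex. -/
def unif (V : Type*) [Fintype V] : ℝ := (Fintype.card V : ℝ)⁻¹

/-- The uniform mixing time. -/
def Tmix (G : SimpleGraph V) : ℕ :=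
  sInf {t : ℕ | ∀ x y : V, |Kpow G t x y / unif V - 1| ≤ 1 / 4}

/-- The Green's function `g(x,y) = ∑_{t=0}^{Tmix} p^t(x,y)`. -/
def green (G : SimpleGraph V) (x y : V) : ℝ :=
  ∑ t ∈ Finset.range (Tmix G + 1), Kpow G t x y

/-- The kernel killed on (entering) the set `S`. -/
def Kkill (G : SimpleGraph V) (S : Finset V) (x y : V) : ℝ :=
  if y ∈ S then 0 else K G x y

/-- Powers of the killed kernel. -/
def KkillPow (G : SimpleGraph V) (S : Finset V) : ℕ → V → V → ℝ
  | 0 => fun x y => if x = y then 1 else 0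
  | t + 1 => fun x y => ∑ z, KkillPow G S t x z * Kkill G S z y

/-- `P_x[τ(S) ≤ T]`, the probability that the lazy walk started at `x` visits `S`
by time `T`. -/
def hitBy (G : SimpleGraph V) (S : Finset V) (x : V) (T : ℕ) : ℝ :=
  if x ∈ S then 1 else 1 - ∑ z, KkillPow G S T x z

/-- `f_{n,c}(x,y) = P_x[τ(y) ≤ c T_mix]`. -/
def fnc (G : SimpleGraph V) (c : ℝ) (x y : V) : ℝ :=
  hitBy G {y} x ⌊c * (Tmix G : ℝ)⌋₊

/-- `f̄_{n,c} = ∑_y f_{n,c}(x,y) π(y)` (averaged also over `x`; by vertex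
transitivity this agrees with the value for any fixed `x`). -/
def fbar (G : SimpleGraph V) (c : ℝ) : ℝ :=
  (∑ x : V, ∑ y : V, fnc G c x y) / (Fintype.card V : ℝ) ^ 2

/-- `F_{n,c} = ∑_{x,y} (f_{n,c}(x,y) - f̄_{n,c})^2`. -/
def Fquad (G : SimpleGraph V) (c : ℝ) : ℝ :=
  ∑ x : V, ∑ y : V, (fnc G c x y - fbar G c) ^ 2

/-- `Γ_n = c₀ T_mix log |V|`. -/
def gammaTime (G : SimpleGraph V) (c₀ : ℝ) : ℕ :=
  ⌊c₀ * (Tmix G : ℝ) * Real.log (Fintype.card V)⌋₊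

/-- `P_x[X_t = z | τ(y) ≥ t]` as a combinatorial formula (meaningful for
`x ≠ y` and `t ≥ 1`). -/
def condAtProb (G : SimpleGraph V) (y x z : V) (t : ℕ) : ℝ :=
  (∑ w, KkillPow G {y} (t - 1) x w * K G w z) / (∑ w, KkillPow G {y} (t - 1) x w)

/-- `∑_{t=0}^{c T_mix} p^t(x,y)`. -/
def greenC (G : SimpleGraph V) (c : ℝ) (x y : V) : ℝ :=
  ∑ t ∈ Finset.range (⌊c * (Tmix G : ℝ)⌋₊ + 1), Kpow G t x y

/-- A graph is vertex transitive if its automorphism group acts transitively. -/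
def IsVertexTransitive (G : SimpleGraph V) : Prop :=
  ∀ x y : V, ∃ e : G ≃g G, e x = y

/-- The probability of a trajectory prefix for the lazy walk with initial
distribution `init`. -/
def walkP (G : SimpleGraph V) (init : V → ℝ) (n : ℕ) (v : ℕ → V) : ℝ :=
  init (v 0) * ∏ i ∈ Finset.range n, K G (v i) (v (i + 1))

/-- Point mass initial distribution. -/
def delta (x : V) : V → ℝ := fun y => if y = x then 1 else 0

/-- Uniform initial distribution. -/
def uinit (V : Type*) [Fintype V] : V → ℝ := fun _ => (Fintype.card V : ℝ)⁻¹

/-- `X₁, X₂` are independent lazy random walks on `G` with initial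
distributions `init₁, init₂`, defined on the probability space `(Ω, P)`:
all finite-dimensional distributions factorize as products of trajectory-prefix
probabilities. -/
structure IsWalkPair {Ω : Type*} [MeasurableSpace Ω] (G : SimpleGraph V) (P : Measure Ω)
    (X₁ X₂ : ℕ → Ω → V) (init₁ init₂ : V → ℝ) : Prop where
  meas₁ : ∀ (t : ℕ) (x : V), MeasurableSet {ω | X₁ t ω = x}
  meas₂ : ∀ (t : ℕ) (x : V), MeasurableSet {ω | X₂ t ω = x}
  law : ∀ (n : ℕ) (v w : ℕ → V),
    (P {ω | (∀ i ≤ n, X₁ i ω = v i) ∧ ∀ i ≤ n, X₂ i ω = w i}).toReal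
      = walkP G init₁ n v * walkP G init₂ n w

/-- `X₁, X₂` are independent stationary lazy random walks on `G`, together with
a family `ξ` of independent fair coins (one per vertex, used to break ties),
all defined on the probability space `(Ω, P)`. -/
structure IsPaintSetup {Ω : Type*} [MeasurableSpace Ω] (G : SimpleGraph V) (P : Measure Ω)
    (X₁ X₂ : ℕ → Ω → V) (ξ : V → Ω → Bool) : Prop where
  meas₁ : ∀ (t : ℕ) (x : V), MeasurableSet {ω | X₁ t ω = x}
  meas₂ : ∀ (t : ℕ) (x : V), MeasurableSet {ω | X₂ t ω = x}
  measξ : ∀ x : V, MeasurableSet {ω | ξ x ω = true}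
  law : ∀ (n : ℕ) (v w : ℕ → V) (b : V → Bool),
    (P {ω | ((∀ i ≤ n, X₁ i ω = v i) ∧ ∀ i ≤ n, X₂ i ω = w i) ∧ ∀ x, ξ x ω = b x}).toReal
      = walkP G (uinit V) n v * walkP G (uinit V) n w * (1 / 2) ^ Fintype.card V

/-- The hitting time `τ(x)` of a vertex `x` (with value `⊤` if `x` is never visited). -/
def hitTime {Ω : Type*} (X : ℕ → Ω → V) (x : V) (ω : Ω) : ℕ∞ :=
  ⨅ (s : ℕ) (_ : X s ω = x), (s : ℕ∞)

/-- `τ(x,y) = τ(x) ⊓ τ(y)`. -/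
def hitTime2 {Ω : Type*} (X : ℕ → Ω → V) (x y : V) (ω : Ω) : ℕ∞ :=
  min (hitTime X x ω) (hitTime X y ω)

/-- `|𝒜₁|`: the number of vertices first visited by `X₁` (ties broken by the coins `ξ`). -/
def paintedCount {Ω : Type*} (X₁ X₂ : ℕ → Ω → V) (ξ : V → Ω → Bool) (ω : Ω) : ℕ :=
  Nat.card {x : V // hitTime X₁ x ω < hitTime X₂ x ω ∨
    (hitTime X₁ x ω = hitTime X₂ x ω ∧ ξ x ω = true)}

/-- The event `H(x,y) = {τ₁(x) < min(τ₁(y), τ₂(x), τ₂(y))}`. -/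
def Hevent {Ω : Type*} (X₁ X₂ : ℕ → Ω → V) (x y : V) : Set Ω :=
  {ω | hitTime X₁ x ω < min (hitTime X₁ y ω) (min (hitTime X₂ x ω) (hitTime X₂ y ω))}

/-- `Y₂ = X₂(τ₁(x,y))`. -/
def Ytwo {Ω : Type*} (X₁ X₂ : ℕ → Ω → V) (x y : V) (ω : Ω) : V :=
  X₂ (hitTime2 X₁ x y ω).toNat ω

/-- `π̃(z;x,y) = P[X₂(τ₁(x,y)) = z | H(x,y)]`. -/
def pitilde {Ω : Type*} [MeasurableSpace Ω] (P : Measure Ω) (X₁ X₂ : ℕ → Ω → V) (x y z : V) : ℝ :=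
  (P (Hevent X₁ X₂ x y ∩ {ω | Ytwo X₁ X₂ x y ω = z})).toReal
    / (P (Hevent X₁ X₂ x y)).toReal

/-- The event `A(x,y) = {τ₁(x,y) ≥ τ₂(x,y) > τ₁(x,y) - Γ, τ₁(x) < τ₁(y)}`. -/
def Aevent {Ω : Type*} (X₁ X₂ : ℕ → Ω → V) (x y : V) (Γ : ℕ) : Set Ω :=
  {ω | hitTime2 X₂ x y ω ≤ hitTime2 X₁ x y ω ∧
    hitTime2 X₁ x y ω - (Γ : ℕ∞) < hitTime2 X₂ x y ω ∧
    hitTime X₁ x ω < hitTime X₁ y ω}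

/-- Conditional probability `P[A | B]`. -/
def condGiven {Ω : Type*} [MeasurableSpace Ω] (P : Measure Ω) (A B : Set Ω) : ℝ :=
  (P (A ∩ B)).toReal / (P B).toReal

/-- Assumption 1 of the paper. -/
structure Assumption1 (V : ℕ → Type*) [∀ n, Fintype (V n)]
    (G : ∀ n, SimpleGraph (V n)) : Prop where
  conn : ∀ n, (G n).Connected
  vt : ∀ n, IsVertexTransitive (G n)
  card_top : Tendsto (fun n => Fintype.card (V n)) atTop atTop
  tmix_small : Tendsto (fun n =>
    (Tmix (G n) : ℝ) * (Real.log (Fintype.card (V n))) ^ 2 / (Fintype.card (V n) : ℝ))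
    atTop (nhds 0)
  tmix_top : Tendsto (fun n => Tmix (G n)) atTop atTop
  green_sq_small : ∃ ε : ℕ → ℝ, Tendsto ε atTop (nhds 0) ∧
    ∀ n, ∀ x : V n, ∑ y ∈ Finset.univ.erase x, (green (G n) x y) ^ 2
      ≤ ε n * (Tmix (G n) : ℝ) / Real.log (Fintype.card (V n))
  hit_miss : ∃ ρ : ℝ, ρ < 1 ∧ ∀ n, ∀ x y z : V n, x ≠ y → x ≠ z → y ≠ z →
    hitBy (G n) {y, z} x (Tmix (G n)) ≤ ρ

/-- The discrete torus `ℤ_n^d`. -/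
def torus (d n : ℕ) : SimpleGraph (Fin d → ZMod n) where
  Adj x y := x ≠ y ∧ ∃ i, y - x = Pi.single i 1 ∨ x - y = Pi.single i 1
  symm := by
    refine ⟨?_⟩
    rintro x y ⟨hne, i, h | h⟩
    · exact ⟨hne.symm, i, Or.inr h⟩
    · exact ⟨hne.symm, i, Or.inl h⟩
  loopless := ⟨fun x h => h.1 rfl⟩

/-- The hypercube `ℤ_2^n`. -/
def hypercube (n : ℕ) : SimpleGraph (Fin n → Bool) where
  Adj x y := x ≠ y ∧ ∃ i, ∀ j, j ≠ i → x j = y j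
  symm := by
    refine ⟨?_⟩
    rintro x y ⟨hne, i, h⟩
    exact ⟨hne.symm, i, fun j hj => (h j hj).symm⟩
  loopless := ⟨fun x h => h.1 rfl⟩

/-- The Cayley graph of the symmetric group `S_n` generated by the transpositions. -/
def transpositionGraph (n : ℕ) : SimpleGraph (Equiv.Perm (Fin n)) where
  Adj σ τ := (σ * τ⁻¹).IsSwap
  symm := by
    refine ⟨?_⟩
    rintro σ τ ⟨a, b, hab, h⟩
    exact ⟨a, b, hab, by rw [show τ * σ⁻¹ = (σ * τ⁻¹)⁻¹ by group, h, Equiv.swap_inv]⟩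
  loopless := by
    refine ⟨?_⟩
    intro σ h
    obtain ⟨a, b, hab, h⟩ := h
    rw [mul_inv_cancel] at h
    exact hab (by simpa [Equiv.swap_apply_left] using Equiv.ext_iff.mp h a)

/-- One-step kernel of the lazy simple random walk on `ℤ^d`. -/
def KZ (d : ℕ) (x y : Fin d → ℤ) : ℝ :=
  if x = y then 1 / 2
  else if ∃ i, y - x = Pi.single i 1 ∨ x - y = Pi.single i 1 then 1 / (4 * d) else 0

/-- `t`-step kernel of the lazy simple random walk on `ℤ^d`. -/
def KZpow (d : ℕ) : ℕ → (Fin d → ℤ) → (Fin d → ℤ) → ℝ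
  | 0 => fun x y => if x = y then 1 else 0
  | t + 1 => fun x y => ∑' z, KZpow d t x z * KZ d z y

/-- The Green's function `G(x; ℤ^d) = ∑_{t=0}^∞ p^t(0,x)` of the lazy walk on `ℤ^d`. -/
def greenZ (d : ℕ) (x : Fin d → ℤ) : ℝ := ∑' t : ℕ, KZpow d t 0 x

/-- `α_d` for `d ≥ 5`. -/
def alphaHigh (d : ℕ) : ℝ := (∑' y : Fin d → ℤ, (greenZ d y) ^ 2) / (greenZ d 0) ^ 2

/-- The normalization `h_d(n)`. -/
def hfun (d n : ℕ) : ℝ :=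
  if d = 3 then (n : ℝ) ^ 4
  else if d = 4 then (n : ℝ) ^ 4 * Real.log n
  else (n : ℝ) ^ d

/-- Matrix powers of an abstract kernel. -/
def mpow (p : V → V → ℝ) : ℕ → V → V → ℝ
  | 0 => fun x y => if x = y then 1 else 0
  | t + 1 => fun x y => ∑ z, mpow p t x z * p z y

/-- Total variation distance between two (probability) vectors. -/
def tvDist (μ ν : V → ℝ) : ℝ := (1 / 2) * ∑ x, |μ x - ν x|



/-! ### Part A: generic finite Markov chain facts -/

lemma Kpow_succ_left (G : SimpleGraph V) (t : ℕ) (x y : V) :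
    Kpow G (t + 1) x y = ∑ w, K G x w * Kpow G t w y := by
  induction t generalizing y with
  | zero => simp [Kpow]
  | succ t ih =>
    rw [Kpow]
    simp_rw [ih]
    simp_rw [Finset.sum_mul]
    rw [Finset.sum_comm]
    refine Finset.sum_congr rfl fun w _ => ?_
    rw [Kpow, Finset.mul_sum]
    exact Finset.sum_congr rfl fun z _ => by ring

lemma KkillPow_succ_left (G : SimpleGraph V) (S : Finset V) (t : ℕ) (x y : V) :
    KkillPow G S (t + 1) x y = ∑ w, Kkill G S x w * KkillPow G S t w y := by
  induction t generalizing y with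
  | zero => simp [KkillPow]
  | succ t ih =>
    rw [KkillPow]
    simp_rw [ih]
    simp_rw [Finset.sum_mul]
    rw [Finset.sum_comm]
    refine Finset.sum_congr rfl fun w _ => ?_
    rw [KkillPow, Finset.mul_sum]
    exact Finset.sum_congr rfl fun z _ => by ring

lemma hitBy_self (G : SimpleGraph V) (y : V) (T : ℕ) : hitBy G {y} y T = 1 := by
  simp [hitBy]

lemma hitBy_zero (G : SimpleGraph V) {x y : V} (h : x ≠ y) : hitBy G {y} x 0 = 0 := by
  simp [hitBy, h, KkillPow]

lemma hitBy_succ (G : SimpleGraph V) (hK : ∀ x, ∑ y, K G x y = 1) {x y : V} (h : x ≠ y) (T : ℕ) :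
    hitBy G {y} x (T + 1) = ∑ w, K G x w * hitBy G {y} w T := by
  rw [hitBy, if_neg (by simpa using h)]
  simp_rw [KkillPow_succ_left]
  rw [Finset.sum_comm, ← hK x, ← Finset.sum_sub_distrib]
  refine Finset.sum_congr rfl fun w _ => ?_
  rw [← Finset.mul_sum]
  unfold hitBy Kkill
  split_ifs <;> ring

lemma K_nonneg (G : SimpleGraph V) (x y : V) : 0 ≤ K G x y := by
  unfold K; split_ifs <;> positivity

lemma Kpow_nonneg (G : SimpleGraph V) (t : ℕ) (x y : V) : 0 ≤ Kpow G t x y := by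
  induction t generalizing y with
  | zero => simp only [Kpow]; split_ifs <;> norm_num
  | succ t ih => exact Finset.sum_nonneg fun z _ => mul_nonneg (ih z) (K_nonneg G z y)

lemma hitBy_nonneg (G : SimpleGraph V) (hK : ∀ x, ∑ y, K G x y = 1) (x y : V) (T : ℕ) :
    0 ≤ hitBy G {y} x T := by
  induction T generalizing x with
  | zero =>
    by_cases h : x = y
    · subst h; rw [hitBy_self]; norm_num
    · rw [hitBy_zero G h]
  | succ T ih =>
    by_cases h : x = y
    · subst h; rw [hitBy_self]; norm_num
    · rw [hitBy_succ G hK h]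
      exact Finset.sum_nonneg fun w _ => mul_nonneg (K_nonneg G x w) (ih w)

/-- truncated Green function -/
def gr (G : SimpleGraph V) (T : ℕ) (x y : V) : ℝ := ∑ t ∈ Finset.range (T + 1), Kpow G t x y

lemma gr_nonneg (G : SimpleGraph V) (T : ℕ) (x y : V) : 0 ≤ gr G T x y :=
  Finset.sum_nonneg fun t _ => Kpow_nonneg G t x y

lemma gr_mono (G : SimpleGraph V) {S T : ℕ} (h : S ≤ T) (x y : V) : gr G S x y ≤ gr G T x y :=
  Finset.sum_le_sum_of_subset_of_nonneg (by gcongr) fun t _ _ => Kpow_nonneg G t x y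

lemma gr_succ (G : SimpleGraph V) (T : ℕ) {x y : V} (h : x ≠ y) :
    gr G (T + 1) x y = ∑ w, K G x w * gr G T w y := by
  unfold gr
  rw [Finset.sum_range_succ']
  simp_rw [Kpow_succ_left, Finset.mul_sum]
  rw [Finset.sum_comm]
  simp [Kpow, h]

lemma gr_le_hit (G : SimpleGraph V) (hK : ∀ x, ∑ y, K G x y = 1) (T : ℕ) (x y : V) :
    gr G T x y ≤ hitBy G {y} x T * gr G T y y := by
  induction T generalizing x with
  | zero =>
    by_cases h : x = y
    · subst h; rw [hitBy_self]; simp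
    · rw [hitBy_zero G h]; simp [gr, Kpow, h]
  | succ T ih =>
    by_cases h : x = y
    · subst h; rw [hitBy_self]; simp
    · rw [gr_succ G T h, hitBy_succ G hK h]
      calc ∑ w, K G x w * gr G T w y ≤ ∑ w, K G x w * (hitBy G {y} w T * gr G T y y) :=
            Finset.sum_le_sum fun w _ => mul_le_mul_of_nonneg_left (ih w) (K_nonneg G x w)
        _ = (∑ w, K G x w * hitBy G {y} w T) * gr G T y y := by
            rw [Finset.sum_mul]; exact Finset.sum_congr rfl fun w _ => by ring
        _ ≤ _ := by
            refine mul_le_mul_of_nonneg_left (gr_mono G (Nat.le_succ T) y y) ?_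
            exact Finset.sum_nonneg fun w _ => mul_nonneg (K_nonneg G x w) (hitBy_nonneg G hK _ _ _)

lemma hit_le_gr (G : SimpleGraph V) (hK : ∀ x, ∑ y, K G x y = 1) (T S : ℕ) (x y : V) :
    hitBy G {y} x T * gr G S y y ≤ gr G (T + S) x y := by
  induction T generalizing x with
  | zero =>
    by_cases h : x = y
    · subst h; rw [hitBy_self]; simp
    · rw [hitBy_zero G h]; simpa using gr_nonneg G _ _ _
  | succ T ih =>
    by_cases h : x = y
    · subst h; rw [hitBy_self, one_mul]; exact gr_mono G (by omega) _ _
    · rw [show T + 1 + S = (T + S) + 1 by ring, gr_succ G _ h, hitBy_succ G hK h, Finset.sum_mul]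
      refine Finset.sum_le_sum fun w _ => ?_
      rw [mul_assoc]
      exact mul_le_mul_of_nonneg_left (ih w) (K_nonneg G x w)

/-! ### Part B: the torus kernel and Fourier analysis -/

/-- the six steps -/
def st (n : ℕ) (p : Fin 3 × Bool) : Fin 3 → ZMod n :=
  if p.2 then Pi.single p.1 1 else - Pi.single p.1 1

lemma zmod_one_ne {n : ℕ} (hn : 3 ≤ n) : (1 : ZMod n) ≠ 0 ∧ (1 : ZMod n) ≠ -1 := by
  constructor
  · intro h
    have : ((1 : ℕ) : ZMod n) = 0 := by simpa using h
    rw [ZMod.natCast_eq_zero_iff] at this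
    have := Nat.le_of_dvd (by norm_num) this
    omega
  · intro h
    have : ((2 : ℕ) : ZMod n) = 0 := by
      have h2 : (1 : ZMod n) + 1 = 0 := by nth_rewrite 1 [h]; ring
      push_cast; rw [← h2]; norm_num
    rw [ZMod.natCast_eq_zero_iff] at this
    have := Nat.le_of_dvd (by norm_num) this
    omega

lemma st_ne_zero {n : ℕ} (hn : 3 ≤ n) (p : Fin 3 × Bool) : st n p ≠ 0 := by
  obtain ⟨i, b⟩ := p
  intro h
  have := congrFun h i
  have h1 := (zmod_one_ne hn).1
  cases b <;> simp [st] at this <;> exact h1 this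

lemma st_inj {n : ℕ} (hn : 3 ≤ n) : Function.Injective (st n) := by
  rintro ⟨i, b⟩ ⟨j, b'⟩ h
  obtain ⟨h1, h2⟩ := zmod_one_ne hn
  have hi := congrFun h i
  by_cases hij : i = j
  · subst hij
    cases b <;> cases b' <;> simp [st] at hi ⊢
    · exact h2 hi.symm
    · exact h2 hi
  · exfalso
    cases b <;> cases b' <;> simp [st, hij] at hi <;> exact h1 hi

lemma torus_adj_iff {n : ℕ} (hn : 3 ≤ n) (x y : Fin 3 → ZMod n) :
    (torus 3 n).Adj x y ↔ ∃ p, y = x + st n p := by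
  constructor
  · rintro ⟨_, i, h | h⟩
    · exact ⟨(i, true), by simp only [st, if_true]; rw [← h]; abel⟩
    · refine ⟨(i, false), ?_⟩
      simp only [st, Bool.false_eq_true, if_false]; rw [← h]; abel
  · rintro ⟨⟨i, b⟩, rfl⟩
    refine ⟨?_, i, ?_⟩
    · intro h
      exact st_ne_zero hn (i, b) (by simpa using h)
    · cases b
      · right; simp [st]
      · left; simp [st]

lemma torus_deg {n : ℕ} [NeZero n] (hn : 3 ≤ n) (x : Fin 3 → ZMod n) :
    deg (torus 3 n) x = 6 := by
  unfold deg
  have : (Finset.univ.filter fun y => (torus 3 n).Adj x y)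
      = Finset.univ.image (fun p => x + st n p) := by
    ext y
    simp [torus_adj_iff hn, eq_comm]
  rw [this, Finset.card_image_of_injective _ (fun p q h => st_inj hn (by simpa using h))]
  simp

lemma torus_K {n : ℕ} [NeZero n] (hn : 3 ≤ n) (x y : Fin 3 → ZMod n) :
    K (torus 3 n) x y = 1 / 2 * (if y = x then 1 else 0)
      + 1 / 12 * ∑ p, (if y = x + st n p then 1 else 0) := by
  unfold K
  rw [torus_deg hn]
  by_cases h : x = y
  · subst h
    have : ∀ p, ¬ (x = x + st n p) := fun p h => st_ne_zero hn p (by simpa using h)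
    simp [this]
  · rw [if_neg h, if_neg (Ne.symm h)]
    by_cases h2 : (torus 3 n).Adj x y
    · rw [if_pos h2]
      obtain ⟨p, rfl⟩ := (torus_adj_iff hn x y).1 h2
      rw [Finset.sum_eq_single p]
      · simp; norm_num
      · intro q _ hq
        rw [if_neg]
        intro h3
        exact hq (st_inj hn (by simpa using h3)).symm
      · simp
    · rw [if_neg h2, Finset.sum_eq_zero]
      · simp
      · intro p _
        rw [if_neg]
        intro h3
        exact h2 ((torus_adj_iff hn x y).2 ⟨p, h3⟩)

lemma torus_sum_K {n : ℕ} [NeZero n] (hn : 3 ≤ n) (x : Fin 3 → ZMod n)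
    (φ : (Fin 3 → ZMod n) → ℝ) :
    ∑ y, K (torus 3 n) x y * φ y = 1 / 2 * φ x + 1 / 12 * ∑ p, φ (x + st n p) := by
  simp_rw [torus_K hn, add_mul, Finset.sum_add_distrib, mul_assoc, ← Finset.mul_sum,
    Finset.sum_mul]
  rw [Finset.sum_comm]
  simp

lemma torus_K_row {n : ℕ} [NeZero n] (hn : 3 ≤ n) (x : Fin 3 → ZMod n) :
    ∑ y, K (torus 3 n) x y = 1 := by
  have := torus_sum_K hn x (fun _ => 1)
  simp only [mul_one] at this
  rw [this]
  simp; norm_num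

lemma Kpow_step {n : ℕ} [NeZero n] (hn : 3 ≤ n) (t : ℕ) (x y : Fin 3 → ZMod n) :
    Kpow (torus 3 n) (t + 1) x y = 1 / 2 * Kpow (torus 3 n) t x y
      + 1 / 12 * ∑ p, Kpow (torus 3 n) t (x + st n p) y := by
  rw [Kpow_succ_left, torus_sum_K hn x (fun w => Kpow (torus 3 n) t w y)]

/-- characters -/
def chi {n : ℕ} [NeZero n] (k z : Fin 3 → ZMod n) : ℂ := ZMod.stdAddChar (∑ i, k i * z i)

/-- eigenvalue at an integer frequency -/
def Lam (n : ℕ) (m : Fin 3 → ℤ) : ℝ := 1 / 2 + 1 / 6 * ∑ i, Real.cos (2 * Real.pi * m i / n)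

/-- minimal lift -/
def lift3 {n : ℕ} (k : Fin 3 → ZMod n) : Fin 3 → ℤ := fun i => (k i).valMinAbs

lemma chi_add {n : ℕ} [NeZero n] (k z w : Fin 3 → ZMod n) : chi k (z + w) = chi k z * chi k w := by
  unfold chi
  rw [← AddChar.map_add_eq_mul]
  simp [mul_add, Finset.sum_add_distrib]

lemma chi_zero_right {n : ℕ} [NeZero n] (k : Fin 3 → ZMod n) : chi k 0 = 1 := by
  simp [chi]

lemma chi_zero_left {n : ℕ} [NeZero n] (k : Fin 3 → ZMod n) : chi 0 k = 1 := by
  simp [chi]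

lemma norm_chi {n : ℕ} [NeZero n] (k z : Fin 3 → ZMod n) : ‖chi k z‖ = 1 := by
  simp [chi]

lemma chi_comm {n : ℕ} [NeZero n] (k z : Fin 3 → ZMod n) : chi k z = chi z k := by
  simp [chi, mul_comm]

lemma sum_chi {n : ℕ} [NeZero n] (z : Fin 3 → ZMod n) :
    ∑ k, chi k z = if z = 0 then (n : ℂ) ^ 3 else 0 := by
  have h1 : ∀ k : Fin 3 → ZMod n, chi k z = ∏ i, ZMod.stdAddChar (k i * z i) := by
    intro k
    simp only [chi, Fin.sum_univ_three, Fin.prod_univ_three, AddChar.map_add_eq_mul]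
  simp_rw [h1]
  have h2 := Finset.prod_univ_sum (fun _ : Fin 3 => (Finset.univ : Finset (ZMod n)))
    (fun i j => (ZMod.stdAddChar (j * z i) : ℂ))
  rw [Fintype.piFinset_univ] at h2
  rw [← h2]
  simp_rw [AddChar.sum_mulShift _ (ZMod.isPrimitive_stdAddChar n)]
  by_cases h : z = 0
  · subst h; simp [ZMod.card]
  · rw [if_neg h]
    obtain ⟨i, hi⟩ : ∃ i, z i ≠ 0 := by
      by_contra hh; push Not at hh; exact h (funext hh)
    exact Finset.prod_eq_zero (Finset.mem_univ i) (by simp [hi])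

lemma std_add_neg {n : ℕ} [NeZero n] (a : ZMod n) :
    (ZMod.stdAddChar a : ℂ) + ZMod.stdAddChar (-a)
      = ((2 * Real.cos (2 * Real.pi * (a.valMinAbs : ℝ) / n) : ℝ) : ℂ) := by
  have h1 : (ZMod.stdAddChar a : ℂ) = Complex.exp (2 * Real.pi * Complex.I * a.valMinAbs / n) := by
    rw [← ZMod.stdAddChar_coe, ZMod.coe_valMinAbs]
  have h2 : (ZMod.stdAddChar (-a) : ℂ)
      = Complex.exp (2 * Real.pi * Complex.I * ((-a.valMinAbs : ℤ) : ℂ) / n) := by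
    rw [← ZMod.stdAddChar_coe]; simp [ZMod.coe_valMinAbs]
  rw [h1, h2]
  push_cast
  rw [Complex.two_cos]
  congr 2 <;> ring

lemma sum_chi_st {n : ℕ} [NeZero n] (k : Fin 3 → ZMod n) :
    1 / 2 + 1 / 12 * ∑ p, chi k (st n p) = ((Lam n (lift3 k) : ℝ) : ℂ) := by
  rw [Fintype.sum_prod_type]
  have : ∀ i, ∑ b, chi k (st n (i, b))
      = ((2 * Real.cos (2 * Real.pi * ((lift3 k i : ℤ) : ℝ) / n) : ℝ) : ℂ) := by
    intro i
    rw [Fintype.sum_bool]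
    unfold lift3
    rw [← std_add_neg]
    simp [chi, st, Pi.single_apply]
  simp_rw [this]
  unfold Lam
  push_cast
  rw [← Finset.mul_sum]
  ring

lemma Kpow_fourier {n : ℕ} [NeZero n] (hn : 3 ≤ n) (t : ℕ) (x y : Fin 3 → ZMod n) :
    ((Kpow (torus 3 n) t x y : ℝ) : ℂ)
      = ((n : ℂ) ^ 3)⁻¹ * ∑ k, ((Lam n (lift3 k) : ℝ) : ℂ) ^ t * chi k (x - y) := by
  have hn0 : (n : ℂ) ≠ 0 := by exact_mod_cast NeZero.ne n
  induction t generalizing x with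
  | zero =>
    simp only [pow_zero, one_mul, sum_chi, Kpow, sub_eq_zero]
    split_ifs <;> simp [hn0]
  | succ t ih =>
    rw [Kpow_step hn]
    push_cast
    simp_rw [ih]
    rw [← Finset.mul_sum, Finset.sum_comm, mul_left_comm, mul_left_comm (1 / 12 : ℂ), ← mul_add,
      Finset.mul_sum, Finset.mul_sum, ← Finset.sum_add_distrib]
    congr 1
    refine Finset.sum_congr rfl fun k _ => ?_
    simp_rw [add_sub_right_comm, chi_add k (x - y)]
    rw [pow_succ, ← sum_chi_st, ← Finset.mul_sum, ← Finset.mul_sum]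
    ring

/-! ### Part C: consequences of the Fourier formula -/

lemma chi_neg {n : ℕ} [NeZero n] (k z : Fin 3 → ZMod n) :
    chi k (-z) = (starRingEnd ℂ) (chi k z) := by
  unfold chi
  rw [← AddChar.map_neg_eq_conj]
  simp

lemma parseval_z {n : ℕ} [NeZero n] (u : (Fin 3 → ZMod n) → ℝ) (c : (Fin 3 → ZMod n) → ℝ)
    (h : ∀ z, ((u z : ℝ) : ℂ) = ((n : ℂ) ^ 3)⁻¹ * ∑ k, (c k : ℂ) * chi k z) :
    ∑ z, u z ^ 2 = ((n : ℝ) ^ 3)⁻¹ * ∑ k, c k ^ 2 := by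
  have hn0 : (n : ℂ) ≠ 0 := by exact_mod_cast NeZero.ne n
  have h1 : ∀ z, ((u z : ℝ) : ℂ) ^ 2
      = ((n : ℂ) ^ 3)⁻¹ * ((n : ℂ) ^ 3)⁻¹ * ∑ k, ∑ l, (c k : ℂ) * c l * chi z (k - l) := by
    intro z
    have h2 : ((u z : ℝ) : ℂ) = ((n : ℂ) ^ 3)⁻¹ * ∑ k, (c k : ℂ) * chi k (-z) := by
      have := congrArg (starRingEnd ℂ) (h z)
      rw [Complex.conj_ofReal] at this
      rw [this]
      simp [chi_neg]
    rw [sq]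
    nth_rewrite 1 [h z]
    rw [h2, mul_mul_mul_comm, Finset.sum_mul_sum]
    congr 1
    refine Finset.sum_congr rfl fun k _ => Finset.sum_congr rfl fun l _ => ?_
    rw [sub_eq_add_neg, chi_add, chi_neg, chi_neg, chi_comm z k, chi_comm z l]
    ring
  have : ((∑ z, u z ^ 2 : ℝ) : ℂ) = ((((n : ℝ) ^ 3)⁻¹ * ∑ k, c k ^ 2 : ℝ) : ℂ) := by
    push_cast
    simp_rw [h1]
    rw [← Finset.mul_sum, Finset.sum_comm]
    have h3 : ∀ k, ∑ z : Fin 3 → ZMod n, ∑ l, (c k : ℂ) * c l * chi z (k - l)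
        = (n : ℂ) ^ 3 * (c k : ℂ) ^ 2 := by
      intro k
      rw [Finset.sum_comm]
      simp_rw [← Finset.mul_sum, sum_chi, sub_eq_zero]
      simp
      ring
    simp_rw [h3]
    rw [← Finset.mul_sum]
    field_simp
  exact_mod_cast this

lemma card_V (n : ℕ) [NeZero n] : (Fintype.card (Fin 3 → ZMod n) : ℝ) = (n : ℝ) ^ 3 := by
  simp [ZMod.card]

lemma parseval_xy {n : ℕ} [NeZero n] (u : (Fin 3 → ZMod n) → (Fin 3 → ZMod n) → ℝ)
    (c : (Fin 3 → ZMod n) → ℝ)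
    (h : ∀ x y, ((u x y : ℝ) : ℂ) = ((n : ℂ) ^ 3)⁻¹ * ∑ k, (c k : ℂ) * chi k (x - y)) :
    ∑ x, ∑ y, u x y ^ 2 = ∑ k, c k ^ 2 := by
  have hn0 : (n : ℝ) ≠ 0 := by exact_mod_cast NeZero.ne n
  have h1 := parseval_z (fun z => u z 0) c (fun z => by simpa using h z 0)
  have h2 : ∀ x y, u x y = u (x - y) 0 := by
    intro x y
    have : ((u x y : ℝ) : ℂ) = ((u (x - y) 0 : ℝ) : ℂ) := by rw [h, h]; simp
    exact_mod_cast this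
  rw [Finset.sum_comm]
  have h3 : ∀ y, ∑ x, u x y ^ 2 = ∑ z, u z 0 ^ 2 := by
    intro y
    simp_rw [h2 _ y]
    exact (Equiv.subRight y).sum_comp (fun z => u z 0 ^ 2)
  simp_rw [h3]
  rw [h1, Finset.sum_const, Finset.card_univ, nsmul_eq_mul, card_V]
  field_simp

lemma lift3_zero {n : ℕ} : lift3 (0 : Fin 3 → ZMod n) = 0 := by
  funext i; simp [lift3]

lemma Lam_zero (n : ℕ) : Lam n 0 = 1 := by
  simp [Lam]; norm_num

lemma Lam_nonneg (n : ℕ) (m : Fin 3 → ℤ) : 0 ≤ Lam n m := by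
  unfold Lam
  have : ∑ _i : Fin 3, (-1 : ℝ) ≤ ∑ i, Real.cos (2 * Real.pi * m i / n) :=
    Finset.sum_le_sum fun i _ => Real.neg_one_le_cos _
  simp at this
  linarith

lemma Lam_le_one (n : ℕ) (m : Fin 3 → ℤ) : Lam n m ≤ 1 := by
  unfold Lam
  have : ∑ i, Real.cos (2 * Real.pi * m i / n) ≤ ∑ _i : Fin 3, (1 : ℝ) :=
    Finset.sum_le_sum fun i _ => Real.cos_le_one _
  simp at this
  linarith

/-- squared norm -/
def qq (m : Fin 3 → ℤ) : ℝ := ∑ i, (m i : ℝ) ^ 2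

lemma lift3_le {n : ℕ} [NeZero n] (k : Fin 3 → ZMod n) (i : Fin 3) :
    |((lift3 k i : ℤ) : ℝ)| ≤ n / 2 := by
  have h := ZMod.natAbs_valMinAbs_le (k i)
  have h2 : 2 * (k i).valMinAbs.natAbs ≤ n := by omega
  have h3 : ((2 * (k i).valMinAbs.natAbs : ℕ) : ℝ) ≤ n := by exact_mod_cast h2
  rw [Nat.cast_mul, Nat.cast_natAbs, Int.cast_abs] at h3
  unfold lift3
  push_cast at h3
  linarith

lemma Lam_gap {n : ℕ} [NeZero n] (k : Fin 3 → ZMod n) :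
    4 / 3 * qq (lift3 k) / n ^ 2 ≤ 1 - Lam n (lift3 k) := by
  have hn : (0 : ℝ) < n := by exact_mod_cast Nat.pos_of_ne_zero (NeZero.ne n)
  have h : ∀ i, Real.cos (2 * Real.pi * (lift3 k i : ℤ) / n)
      ≤ 1 - 8 * ((lift3 k i : ℤ) : ℝ) ^ 2 / n ^ 2 := by
    intro i
    have hl := lift3_le k i
    have h1 : |2 * Real.pi * ((lift3 k i : ℤ) : ℝ) / n| ≤ Real.pi := by
      rw [abs_div, abs_mul, abs_of_pos (by positivity : (0 : ℝ) < 2 * Real.pi), abs_of_pos hn,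
        div_le_iff₀ hn]
      nlinarith [Real.pi_pos]
    have h2 := Real.cos_le_one_sub_mul_cos_sq h1
    have h3 : 2 / Real.pi ^ 2 * (2 * Real.pi * ((lift3 k i : ℤ) : ℝ) / n) ^ 2
        = 8 * ((lift3 k i : ℤ) : ℝ) ^ 2 / n ^ 2 := by
      have := Real.pi_ne_zero
      field_simp; ring
    linarith
  have h4 := Finset.sum_le_sum fun i (_ : i ∈ (Finset.univ : Finset (Fin 3))) => h i
  unfold Lam
  have h5 : ∑ i : Fin 3, (1 - 8 * ((lift3 k i : ℤ) : ℝ) ^ 2 / n ^ 2)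
      = 3 - 8 * qq (lift3 k) / n ^ 2 := by
    unfold qq
    rw [Finset.sum_sub_distrib, Finset.mul_sum, Finset.sum_div]; simp
  rw [h5] at h4
  have h6 : 4 / 3 * qq (lift3 k) / (n : ℝ) ^ 2 = 1 / 6 * (8 * qq (lift3 k) / n ^ 2) := by ring
  rw [h6]
  linarith

lemma Kpow_diag {n : ℕ} [NeZero n] (hn : 3 ≤ n) (t : ℕ) (x : Fin 3 → ZMod n) :
    Kpow (torus 3 n) t x x = ((n : ℝ) ^ 3)⁻¹ * ∑ k : Fin 3 → ZMod n, Lam n (lift3 k) ^ t := by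
  have := Kpow_fourier hn t x x
  simp only [sub_self, chi_zero_right, mul_one] at this
  have h2 : ((Kpow (torus 3 n) t x x : ℝ) : ℂ)
      = ((((n : ℝ) ^ 3)⁻¹ * ∑ k : Fin 3 → ZMod n, Lam n (lift3 k) ^ t : ℝ) : ℂ) := by
    rw [this]; push_cast; rfl
  exact Complex.ofReal_injective h2

lemma Kpow_le_diag {n : ℕ} [NeZero n] (hn : 3 ≤ n) (t : ℕ) (x y : Fin 3 → ZMod n) :
    Kpow (torus 3 n) t x y ≤ ((n : ℝ) ^ 3)⁻¹ * ∑ k : Fin 3 → ZMod n, Lam n (lift3 k) ^ t := by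
  have h := congrArg norm (Kpow_fourier hn t x y)
  rw [Complex.norm_real, Real.norm_of_nonneg (Kpow_nonneg _ _ _ _)] at h
  rw [h, norm_mul]
  gcongr
  · simp
  · refine (norm_sum_le _ _).trans (le_of_eq ?_)
    refine Finset.sum_congr rfl fun k _ => ?_
    rw [norm_mul, norm_chi, mul_one, norm_pow, Complex.norm_real,
      Real.norm_of_nonneg (Lam_nonneg _ _)]

/-- deviation from uniformity -/
def Dn (n : ℕ) [NeZero n] (t : ℕ) : ℝ :=
  ∑ k ∈ Finset.univ.erase (0 : Fin 3 → ZMod n), Lam n (lift3 k) ^ t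

lemma sum_eq_Dn (n : ℕ) [NeZero n] (t : ℕ) :
    ∑ k : Fin 3 → ZMod n, Lam n (lift3 k) ^ t = 1 + Dn n t := by
  rw [Dn, ← Finset.add_sum_erase _ _ (Finset.mem_univ (0 : Fin 3 → ZMod n)), lift3_zero, Lam_zero,
    one_pow]

lemma Dn_nonneg (n : ℕ) [NeZero n] (t : ℕ) : 0 ≤ Dn n t :=
  Finset.sum_nonneg fun _ _ => pow_nonneg (Lam_nonneg _ _) _

lemma Dn_anti (n : ℕ) [NeZero n] {s t : ℕ} (h : s ≤ t) : Dn n t ≤ Dn n s :=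
  Finset.sum_le_sum fun _ _ => pow_le_pow_of_le_one (Lam_nonneg _ _) (Lam_le_one _ _) h

lemma mix_iff {n : ℕ} [NeZero n] (hn : 3 ≤ n) (t : ℕ) :
    (∀ x y : Fin 3 → ZMod n, |Kpow (torus 3 n) t x y / unif (Fin 3 → ZMod n) - 1| ≤ 1 / 4)
      ↔ Dn n t ≤ 1 / 4 := by
  have hn0 : (0 : ℝ) < n := by exact_mod_cast Nat.pos_of_ne_zero (NeZero.ne n)
  have hnc : (n : ℂ) ≠ 0 := by exact_mod_cast NeZero.ne n
  have hu : ∀ a : ℝ, a / unif (Fin 3 → ZMod n) = a * (n : ℝ) ^ 3 := by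
    intro a; unfold unif; rw [card_V, div_inv_eq_mul]
  simp_rw [hu]
  constructor
  · intro h
    have := h 0 0
    rw [Kpow_diag hn, sum_eq_Dn] at this
    rw [mul_comm, mul_inv_cancel_left₀ (by positivity), add_sub_cancel_left] at this
    exact (le_abs_self _).trans this
  · intro h x y
    refine le_trans ?_ h
    have h1 : ((Kpow (torus 3 n) t x y * (n : ℝ) ^ 3 - 1 : ℝ) : ℂ)
        = ∑ k ∈ Finset.univ.erase (0 : Fin 3 → ZMod n),
          ((Lam n (lift3 k) : ℝ) : ℂ) ^ t * chi k (x - y) := by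
      push_cast
      rw [Kpow_fourier hn, mul_comm, mul_inv_cancel_left₀ (pow_ne_zero _ hnc),
        ← Finset.add_sum_erase _ _ (Finset.mem_univ (0 : Fin 3 → ZMod n)), lift3_zero, Lam_zero,
        chi_zero_left]
      simp
    have h2 := congrArg norm h1
    rw [Complex.norm_real, Real.norm_eq_abs] at h2
    rw [h2]
    refine (norm_sum_le _ _).trans (le_of_eq ?_)
    refine Finset.sum_congr rfl fun k _ => ?_
    rw [norm_mul, norm_chi, mul_one, norm_pow, Complex.norm_real,
      Real.norm_of_nonneg (Lam_nonneg _ _)]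

lemma Tmix_eq {n : ℕ} [NeZero n] (hn : 3 ≤ n) :
    Tmix (torus 3 n) = sInf {t : ℕ | Dn n t ≤ 1 / 4} := by
  unfold Tmix
  congr 1
  ext t
  exact mix_iff hn t

/-- eigenvalue of the truncated Green function -/
def cg (n T : ℕ) (m : Fin 3 → ℤ) : ℝ := ∑ t ∈ Finset.range (T + 1), Lam n m ^ t

/-- the variance of the truncated Green function -/
def Wn (n : ℕ) [NeZero n] (T : ℕ) : ℝ :=
  ∑ k ∈ Finset.univ.erase (0 : Fin 3 → ZMod n), cg n T (lift3 k) ^ 2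

lemma cg_zero (n T : ℕ) : cg n T 0 = T + 1 := by simp [cg, Lam_zero]

lemma gr_fourier {n : ℕ} [NeZero n] (hn : 3 ≤ n) (T : ℕ) (x y : Fin 3 → ZMod n) :
    ((gr (torus 3 n) T x y : ℝ) : ℂ)
      = ((n : ℂ) ^ 3)⁻¹ * ∑ k, ((cg n T (lift3 k) : ℝ) : ℂ) * chi k (x - y) := by
  unfold gr cg
  push_cast
  simp_rw [Kpow_fourier hn, ← Finset.mul_sum, Finset.sum_mul]
  rw [Finset.sum_comm]

lemma gr_sq_sum {n : ℕ} [NeZero n] (hn : 3 ≤ n) (T : ℕ) :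
    ∑ x, ∑ y, gr (torus 3 n) T x y ^ 2 = ((T : ℝ) + 1) ^ 2 + Wn n T := by
  rw [parseval_xy _ _ (gr_fourier hn T), Wn,
    ← Finset.add_sum_erase _ _ (Finset.mem_univ (0 : Fin 3 → ZMod n)), lift3_zero, cg_zero]

lemma gr_var_sum {n : ℕ} [NeZero n] (hn : 3 ≤ n) (T : ℕ) :
    ∑ x, ∑ y, (gr (torus 3 n) T x y - ((T : ℝ) + 1) / (n : ℝ) ^ 3) ^ 2 = Wn n T := by
  rw [parseval_xy _ (fun k => if k = 0 then 0 else cg n T (lift3 k))]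
  · rw [Wn, ← Finset.add_sum_erase _ _ (Finset.mem_univ (0 : Fin 3 → ZMod n))]
    simp only [if_true]
    rw [zero_pow two_ne_zero, zero_add]
    refine Finset.sum_congr rfl fun k hk => ?_
    rw [if_neg (Finset.ne_of_mem_erase hk)]
  · intro x y
    push_cast
    rw [gr_fourier hn, ← Finset.add_sum_erase _ _ (Finset.mem_univ (0 : Fin 3 → ZMod n)),
      ← Finset.add_sum_erase _ _ (Finset.mem_univ (0 : Fin 3 → ZMod n)), lift3_zero, cg_zero,
        chi_zero_left]
    have : ∑ k ∈ Finset.univ.erase (0 : Fin 3 → ZMod n),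
        (((if k = 0 then 0 else cg n T (lift3 k) : ℝ)) : ℂ) * chi k (x - y)
        = ∑ k ∈ Finset.univ.erase (0 : Fin 3 → ZMod n),
        ((cg n T (lift3 k) : ℝ) : ℂ) * chi k (x - y) :=
      Finset.sum_congr rfl fun k hk => by rw [if_neg (Finset.ne_of_mem_erase hk)]
    rw [this]
    push_cast
    simp only [if_true, Complex.ofReal_zero]
    ring

/-! ### Part D: dominated convergence over frequencies -/

lemma summable_prod3 (f : ℤ → ℝ) (hf0 : ∀ j, 0 ≤ f j) (hf : Summable f) :
    Summable fun m : Fin 3 → ℤ => ∏ i, f (m i) := by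
  refine summable_of_sum_le (c := ∏ _i : Fin 3, ∑' j, f j)
    (fun m => Finset.prod_nonneg fun i _ => hf0 _) ?_
  intro s
  have hs : s ⊆ Fintype.piFinset fun i : Fin 3 => s.image (fun m => m i) := by
    intro m hm
    rw [Fintype.mem_piFinset]
    exact fun i => Finset.mem_image_of_mem _ hm
  calc ∑ m ∈ s, ∏ i, f (m i)
      ≤ ∑ m ∈ Fintype.piFinset fun i : Fin 3 => s.image (fun m => m i), ∏ i, f (m i) :=
        Finset.sum_le_sum_of_subset_of_nonneg hs fun m _ _ => Finset.prod_nonneg fun i _ => hf0 _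
    _ = ∏ i : Fin 3, ∑ j ∈ s.image (fun m => m i), f j := (Finset.prod_univ_sum _ _).symm
    _ ≤ _ := Finset.prod_le_prod (fun i _ => Finset.sum_nonneg fun j _ => hf0 _)
        fun i _ => hf.sum_le_tsum _ fun j _ => hf0 _

lemma qq_nonneg (m : Fin 3 → ℤ) : 0 ≤ qq m := Finset.sum_nonneg fun _ _ => sq_nonneg _

lemma le_qq (m : Fin 3 → ℤ) (i : Fin 3) : (m i : ℝ) ^ 2 ≤ qq m :=
  Finset.single_le_sum (f := fun i => (m i : ℝ) ^ 2) (fun _ _ => sq_nonneg _) (Finset.mem_univ i)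

lemma one_le_qq {m : Fin 3 → ℤ} (hm : m ≠ 0) : 1 ≤ qq m := by
  obtain ⟨i, hi⟩ : ∃ i, m i ≠ 0 := by
    by_contra hh; push Not at hh; exact hm (funext hh)
  refine le_trans ?_ (le_qq m i)
  have : 1 ≤ (m i) ^ 2 := by
    have := sq_pos_of_ne_zero hi
    omega
  exact_mod_cast this

lemma summable_qq : Summable fun m : Fin 3 → ℤ => ((qq m)⁻¹) ^ 2 := by
  set f : ℤ → ℝ := fun j => |(j : ℝ)| ^ (-(4 / 3) : ℝ) + if j = 0 then 1 else 0 with hf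
  have hf0 : ∀ j, 0 ≤ f j := by
    intro j
    have : (0 : ℝ) ≤ if j = 0 then 1 else 0 := by split_ifs <;> norm_num
    exact add_nonneg (by positivity) this
  have hfs : Summable f := by
    refine (Real.summable_abs_int_rpow (by norm_num : (1 : ℝ) < 4 / 3)).add ?_
    exact summable_of_ne_finset_zero (s := {0}) (fun j hj => by
      rw [if_neg (by simpa using hj)])
  refine Summable.of_nonneg_of_le (fun m => by positivity) ?_ (summable_prod3 f hf0 hfs)
  intro m
  by_cases hm : m = 0
  · subst hm
    have : qq 0 = 0 := by simp [qq]
    rw [this, inv_zero, zero_pow two_ne_zero]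
    exact Finset.prod_nonneg fun i _ => hf0 _
  have h1 := one_le_qq hm
  have h0 : 0 < qq m := by linarith
  have key : ∀ i, (qq m) ^ (-(2 / 3) : ℝ) ≤ f (m i) := by
    intro i
    by_cases hi : m i = 0
    · simp only [hf, hi, if_true]
      have : (qq m) ^ (-(2 / 3) : ℝ) ≤ 1 := Real.rpow_le_one_of_one_le_of_nonpos h1 (by norm_num)
      have h2 : (0 : ℝ) ≤ |((0 : ℤ) : ℝ)| ^ (-(4 / 3) : ℝ) := by positivity
      linarith
    · simp only [hf, hi, if_false, add_zero]
      have hpos : 0 < |(m i : ℝ)| := by simpa using hi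
      have : |(m i : ℝ)| ^ (-(4 / 3) : ℝ) = ((m i : ℝ) ^ 2) ^ (-(2 / 3) : ℝ) := by
        rw [← sq_abs, ← Real.rpow_natCast, ← Real.rpow_mul hpos.le]; norm_num
      rw [this]
      refine Real.rpow_le_rpow_of_nonpos ?_ (le_qq m i) (by norm_num)
      rw [← sq_abs]; positivity
  calc ((qq m)⁻¹) ^ 2 = ∏ _i : Fin 3, (qq m) ^ (-(2 / 3) : ℝ) := by
        rw [Finset.prod_const, Finset.card_univ, Fintype.card_fin, ← Real.rpow_natCast,
          ← Real.rpow_natCast, ← Real.rpow_mul h0.le, ← Real.rpow_neg_one, ← Real.rpow_mul h0.le]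
        norm_num
    _ ≤ _ := Finset.prod_le_prod (fun i _ => by positivity) fun i _ => key i

lemma lift3_inj {n : ℕ} : Function.Injective (lift3 : (Fin 3 → ZMod n) → _) := by
  intro k l h
  funext i
  exact ZMod.injective_valMinAbs (congrFun h i)

lemma lift3_surj_eventually (m : Fin 3 → ℤ) :
    ∀ᶠ n : ℕ in atTop, ∃ k : Fin 3 → ZMod (n + 1), lift3 k = m := by
  filter_upwards [eventually_ge_atTop (2 * ∑ i, (m i).natAbs)] with n hn
  refine ⟨fun i => (m i : ZMod (n + 1)), ?_⟩
  funext i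
  have h1 : (m i).natAbs ≤ ∑ i, (m i).natAbs :=
    Finset.single_le_sum (f := fun i => (m i).natAbs) (fun _ _ => Nat.zero_le _) (Finset.mem_univ i)
  unfold lift3
  rw [ZMod.valMinAbs_spec]
  refine ⟨rfl, ?_⟩
  constructor <;> (push_cast; omega)

lemma tannery_freq (F : ℕ → (Fin 3 → ℤ) → ℝ) (g : (Fin 3 → ℤ) → ℝ) (C : ℝ)
    (hlim : ∀ m, m ≠ 0 → Tendsto (fun n => F n m) atTop (nhds (g m)))
    (hb : ∀ᶠ n : ℕ in atTop, ∀ k : Fin 3 → ZMod (n + 1), k ≠ 0 →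
      |F n (lift3 k)| ≤ C * ((qq (lift3 k))⁻¹) ^ 2) :
    Tendsto (fun n : ℕ => ∑ k ∈ Finset.univ.erase (0 : Fin 3 → ZMod (n + 1)), F n (lift3 k))
      atTop (nhds (∑' m, if m = 0 then 0 else g m)) := by
  set H : ℕ → (Fin 3 → ℤ) → ℝ := fun n m =>
    if m ≠ 0 ∧ ∃ k : Fin 3 → ZMod (n + 1), lift3 k = m then F n m else 0 with hH
  have e : ∀ n : ℕ, ∑ k ∈ Finset.univ.erase (0 : Fin 3 → ZMod (n + 1)), F n (lift3 k)
      = ∑' m, H n m := by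
    intro n
    rw [tsum_eq_sum (s := (Finset.univ.erase (0 : Fin 3 → ZMod (n + 1))).image lift3)]
    · rw [Finset.sum_image (fun a _ b _ h => lift3_inj h)]
      refine Finset.sum_congr rfl fun k hk => ?_
      have hk0 : lift3 k ≠ 0 := by
        intro h
        exact Finset.ne_of_mem_erase hk (lift3_inj (h.trans lift3_zero.symm))
      simp only [hH]
      rw [if_pos ⟨hk0, k, rfl⟩]
    · intro m hm
      simp only [hH]
      rw [if_neg]
      rintro ⟨hm0, k, rfl⟩
      refine hm (Finset.mem_image_of_mem _ (Finset.mem_erase.2 ⟨?_, Finset.mem_univ _⟩))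
      rintro rfl
      exact hm0 lift3_zero
  simp_rw [e]
  refine tendsto_tsum_of_dominated_convergence (bound := fun m => |C| * ((qq m)⁻¹) ^ 2)
    (summable_qq.mul_left _) ?_ ?_
  · intro m
    by_cases hm : m = 0
    · simp [hH, hm]
    · rw [if_neg hm]
      refine (hlim m hm).congr' ?_
      filter_upwards [lift3_surj_eventually m] with n hn
      simp only [hH]
      rw [if_pos ⟨hm, hn⟩]
  · filter_upwards [hb] with n hn m
    simp only [hH]
    split_ifs with h
    · obtain ⟨hm0, k, rfl⟩ := h
      rw [Real.norm_eq_abs]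
      refine (hn k ?_).trans ?_
      · rintro rfl; exact hm0 lift3_zero
      · gcongr; exact le_abs_self C
    · rw [norm_zero]; positivity

lemma cos_lim (a : ℝ) :
    Tendsto (fun n : ℕ => ((n : ℝ) + 1) ^ 2 * (1 - Real.cos (a / ((n : ℝ) + 1))))
      atTop (nhds (a ^ 2 / 2)) := by
  have hN : Tendsto (fun n : ℕ => (n : ℝ) + 1) atTop atTop :=
    tendsto_atTop_add_const_right _ _ tendsto_natCast_atTop_atTop
  have h0 : Tendsto (fun n : ℕ => a / ((n : ℝ) + 1)) atTop (nhds 0) := hN.const_div_atTop a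
  rw [tendsto_iff_norm_sub_tendsto_zero]
  have hz : Tendsto (fun n : ℕ => a ^ 2 * (5 / 96) * (a / ((n : ℝ) + 1)) ^ 2) atTop (nhds 0) := by
    simpa using (h0.pow 2).const_mul (a ^ 2 * (5 / 96))
  refine squeeze_zero' (Eventually.of_forall fun _ => norm_nonneg _) ?_ hz
  have hev : ∀ᶠ n : ℕ in atTop, |a / ((n : ℝ) + 1)| ≤ 1 := by
    have := h0.abs
    rw [abs_zero] at this
    filter_upwards [this.eventually (gt_mem_nhds (zero_lt_one))] with n hn using hn.le
  filter_upwards [hev] with n hn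
  have hb := Real.cos_bound hn
  have hpos : (0 : ℝ) < (n : ℝ) + 1 := by positivity
  have e1 : ((n : ℝ) + 1) ^ 2 * (1 - Real.cos (a / ((n : ℝ) + 1))) - a ^ 2 / 2
      = -(((n : ℝ) + 1) ^ 2 * (Real.cos (a / ((n : ℝ) + 1)) - (1 - (a / ((n : ℝ) + 1)) ^ 2 / 2))) := by
    field_simp; ring
  rw [e1, norm_neg, norm_mul, Real.norm_eq_abs, Real.norm_eq_abs, abs_of_pos (by positivity)]
  calc _ ≤ ((n : ℝ) + 1) ^ 2 * (|a / ((n : ℝ) + 1)| ^ 4 * (5 / 96)) := by gcongr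
    _ = _ := by
      rw [show |a / ((n : ℝ) + 1)| ^ 4 = (a / ((n : ℝ) + 1)) ^ 4 by
        rw [← abs_pow, abs_of_nonneg (by positivity)]]
      field_simp

/-- rescaled eigenvalue -/
def aa (m : Fin 3 → ℤ) : ℝ := Real.pi ^ 2 / 3 * qq m

lemma aa_pos {m : Fin 3 → ℤ} (hm : m ≠ 0) : 0 < aa m := by
  have := one_le_qq hm
  have := Real.pi_pos
  unfold aa; positivity

lemma Lam_lim (m : Fin 3 → ℤ) :
    Tendsto (fun n : ℕ => ((n : ℝ) + 1) ^ 2 * (1 - Lam (n + 1) m)) atTop (nhds (aa m)) := by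
  have h : Tendsto (fun n : ℕ => 1 / 6 * ∑ i, ((n : ℝ) + 1) ^ 2 *
      (1 - Real.cos ((2 * Real.pi * m i) / ((n : ℝ) + 1)))) atTop
      (nhds (1 / 6 * ∑ i, (2 * Real.pi * (m i : ℝ)) ^ 2 / 2)) :=
    (tendsto_finsetSum _ fun i _ => cos_lim _).const_mul _
  have e : 1 / 6 * ∑ i, (2 * Real.pi * (m i : ℝ)) ^ 2 / 2 = aa m := by
    unfold aa qq
    rw [Finset.mul_sum, Finset.mul_sum]
    exact Finset.sum_congr rfl fun i _ => by ring
  rw [e] at h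
  refine h.congr fun n => ?_
  unfold Lam
  push_cast
  rw [← Finset.mul_sum, Finset.sum_sub_distrib]
  simp
  ring

lemma sq_atTop : Tendsto (fun n : ℕ => ((n : ℝ) + 1) ^ 2) atTop atTop :=
  (tendsto_pow_atTop two_ne_zero).comp
    (tendsto_atTop_add_const_right _ _ tendsto_natCast_atTop_atTop)

lemma Lam_lim_one (m : Fin 3 → ℤ) :
    Tendsto (fun n : ℕ => Lam (n + 1) m) atTop (nhds 1) := by
  have h := (Lam_lim m).div_atTop sq_atTop
  have h2 := h.const_sub 1
  rw [sub_zero] at h2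
  refine h2.congr fun n => ?_
  have : (0 : ℝ) < (n : ℝ) + 1 := by positivity
  field_simp
  ring

lemma Lam_pow_lim (m : Fin 3 → ℤ) (T : ℕ → ℕ) (s : ℝ)
    (hT : Tendsto (fun n : ℕ => (T n : ℝ) / ((n : ℝ) + 1) ^ 2) atTop (nhds s)) :
    Tendsto (fun n : ℕ => Lam (n + 1) m ^ T n) atTop (nhds (Real.exp (-(s * aa m)))) := by
  have hu : Tendsto (fun n : ℕ => (T n : ℝ) * (Lam (n + 1) m - 1)) atTop (nhds (-(s * aa m))) := by
    have := (hT.mul (Lam_lim m)).neg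
    refine this.congr fun n => ?_
    have : (0 : ℝ) < (n : ℝ) + 1 := by positivity
    field_simp
    ring
  have hl : Tendsto (fun n : ℕ => (T n : ℝ) * (Lam (n + 1) m - 1) / Lam (n + 1) m) atTop
      (nhds (-(s * aa m))) := by
    have := hu.div (Lam_lim_one m) one_ne_zero
    rwa [div_one] at this
  have hpos : ∀ᶠ n : ℕ in atTop, 0 < Lam (n + 1) m :=
    (Lam_lim_one m).eventually (lt_mem_nhds zero_lt_one)
  have hlog : Tendsto (fun n : ℕ => (T n : ℝ) * Real.log (Lam (n + 1) m)) atTop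
      (nhds (-(s * aa m))) := by
    refine tendsto_of_tendsto_of_tendsto_of_le_of_le' hl hu ?_ ?_
    · filter_upwards [hpos] with n hn
      have := Real.one_sub_inv_le_log_of_pos hn
      rw [mul_div_assoc]
      refine mul_le_mul_of_nonneg_left ?_ (by positivity)
      rwa [sub_div, div_self hn.ne', one_div]
    · filter_upwards [hpos] with n hn
      exact mul_le_mul_of_nonneg_left (Real.log_le_sub_one_of_pos hn) (by positivity)
  refine ((Real.continuous_exp.tendsto _).comp hlog).congr' ?_
  filter_upwards [hpos] with n hn
  simp only [Function.comp]
  rw [mul_comm, Real.exp_mul, Real.exp_log hn, Real.rpow_natCast]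

lemma Lam_pow_le {n : ℕ} [NeZero n] (k : Fin 3 → ZMod n) (t : ℕ) :
    Lam n (lift3 k) ^ t ≤ Real.exp (-(4 / 3 * (t / n ^ 2) * qq (lift3 k))) := by
  have h1 : Lam n (lift3 k) ≤ Real.exp (-(4 / 3 * qq (lift3 k) / n ^ 2)) := by
    have := Real.add_one_le_exp (-(4 / 3 * qq (lift3 k) / (n : ℝ) ^ 2))
    have := Lam_gap k
    linarith
  calc _ ≤ (Real.exp (-(4 / 3 * qq (lift3 k) / n ^ 2))) ^ t :=
        pow_le_pow_left₀ (Lam_nonneg _ _) h1 _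
    _ = _ := by rw [← Real.exp_nat_mul]; congr 1; ring

lemma exp_neg_le {x : ℝ} (hx : 0 < x) : Real.exp (-x) ≤ 2 * (x⁻¹) ^ 2 := by
  have h := Real.quadratic_le_exp_of_nonneg hx.le
  rw [Real.exp_neg, inv_pow]
  have h2 : x ^ 2 / 2 ≤ Real.exp x := by linarith
  calc (Real.exp x)⁻¹ ≤ (x ^ 2 / 2)⁻¹ := inv_anti₀ (by positivity) h2
    _ = _ := by field_simp

/-- limit of the deviation -/
def Th (s : ℝ) : ℝ := ∑' m : Fin 3 → ℤ, if m = 0 then 0 else Real.exp (-(s * aa m))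

lemma Dn_lim (T : ℕ → ℕ) (s : ℝ) (hs : 0 < s)
    (hT : Tendsto (fun n : ℕ => (T n : ℝ) / ((n : ℝ) + 1) ^ 2) atTop (nhds s)) :
    Tendsto (fun n : ℕ => Dn (n + 1) (T n)) atTop (nhds (Th s)) := by
  refine tannery_freq (fun n m => Lam (n + 1) m ^ T n) _ (2 * ((2 / 3 * s)⁻¹) ^ 2)
    (fun m _ => Lam_pow_lim m T s hT) ?_
  filter_upwards [hT.eventually (lt_mem_nhds (half_lt_self hs))] with n hn k hk
  have hk0 : lift3 k ≠ 0 := fun h => hk (lift3_inj (h.trans lift3_zero.symm))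
  have hq := one_le_qq hk0
  rw [abs_of_nonneg (pow_nonneg (Lam_nonneg _ _) _)]
  refine (Lam_pow_le k (T n)).trans ?_
  have h1 : Real.exp (-(4 / 3 * ((T n : ℝ) / ((n + 1 : ℕ) : ℝ) ^ 2) * qq (lift3 k)))
      ≤ Real.exp (-(2 / 3 * s * qq (lift3 k))) := by
    apply Real.exp_le_exp.2
    push_cast
    have : s / 2 * qq (lift3 k) ≤ (T n : ℝ) / ((n : ℝ) + 1) ^ 2 * qq (lift3 k) := by gcongr
    linarith
  refine h1.trans ((exp_neg_le (by positivity)).trans (le_of_eq ?_))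
  rw [mul_inv]; ring

/-- limit of the variance -/
def Wlim (s : ℝ) : ℝ :=
  ∑' m : Fin 3 → ℤ, if m = 0 then 0 else ((1 - Real.exp (-(s * aa m))) / aa m) ^ 2

lemma cg_eq (n T : ℕ) (m : Fin 3 → ℤ) (h : Lam n m ≠ 1) :
    cg n T m = (1 - Lam n m ^ (T + 1)) / (1 - Lam n m) := by
  unfold cg
  rw [geom_sum_eq h, ← neg_div_neg_eq, neg_sub, neg_sub]

lemma cg_nonneg (n T : ℕ) (m : Fin 3 → ℤ) : 0 ≤ cg n T m :=
  Finset.sum_nonneg fun _ _ => pow_nonneg (Lam_nonneg _ _) _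

lemma Wn_lim (T : ℕ → ℕ) (s : ℝ)
    (hT : Tendsto (fun n : ℕ => (T n : ℝ) / ((n : ℝ) + 1) ^ 2) atTop (nhds s)) :
    Tendsto (fun n : ℕ => Wn (n + 1) (T n) / ((n : ℝ) + 1) ^ 4) atTop (nhds (Wlim s)) := by
  have hT1 : Tendsto (fun n : ℕ => ((T n + 1 : ℕ) : ℝ) / ((n : ℝ) + 1) ^ 2) atTop (nhds s) := by
    have := hT.add (sq_atTop.const_div_atTop 1)
    rw [add_zero] at this
    refine this.congr fun n => ?_
    push_cast
    rw [← add_div]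
  have e : ∀ n : ℕ, Wn (n + 1) (T n) / ((n : ℝ) + 1) ^ 4
      = ∑ k ∈ Finset.univ.erase (0 : Fin 3 → ZMod (n + 1)),
        (cg (n + 1) (T n) (lift3 k) / ((n : ℝ) + 1) ^ 2) ^ 2 := by
    intro n
    unfold Wn
    rw [Finset.sum_div]
    exact Finset.sum_congr rfl fun k _ => by rw [div_pow, ← pow_mul]
  simp_rw [e]
  refine tannery_freq (fun n m => (cg (n + 1) (T n) m / ((n : ℝ) + 1) ^ 2) ^ 2) _ ((3 / 4) ^ 2)
    ?_ ?_
  · intro m hm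
    refine Tendsto.pow ?_ 2
    have ha := aa_pos hm
    have h1 := ((Lam_pow_lim m _ s hT1).const_sub 1).div (Lam_lim m) ha.ne'
    refine h1.congr' ?_
    filter_upwards [(Lam_lim m).eventually (lt_mem_nhds ha)] with n hn
    have hne : Lam (n + 1) m ≠ 1 := by
      intro h; rw [h] at hn; simp at hn
    simp only [Pi.div_apply]
    rw [cg_eq _ _ _ hne, div_div, mul_comm]
  · refine Eventually.of_forall fun n k hk => ?_
    have hk0 : lift3 k ≠ 0 := fun h => hk (lift3_inj (h.trans lift3_zero.symm))
    have hq := one_le_qq hk0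
    have hg := Lam_gap k
    have hp : (0 : ℝ) < 4 / 3 * qq (lift3 k) / ((n + 1 : ℕ) : ℝ) ^ 2 := by positivity
    have h1 : 0 < 1 - Lam (n + 1) (lift3 k) := lt_of_lt_of_le hp hg
    rw [abs_of_nonneg (by positivity), ← mul_pow]
    have h2 : cg (n + 1) (T n) (lift3 k) / ((n : ℝ) + 1) ^ 2 ≤ 3 / 4 * (qq (lift3 k))⁻¹ := by
      rw [cg_eq _ _ _ (by intro h; rw [h] at h1; simp at h1)]
      have h3 : (1 - Lam (n + 1) (lift3 k) ^ (T n + 1)) / (1 - Lam (n + 1) (lift3 k))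
          ≤ 1 / (4 / 3 * qq (lift3 k) / ((n + 1 : ℕ) : ℝ) ^ 2) := by
        refine div_le_div₀ zero_le_one ?_ hp hg
        have := pow_nonneg (Lam_nonneg (n + 1) (lift3 k)) (T n + 1)
        linarith
      refine (div_le_div_of_nonneg_right h3 (by positivity)).trans (le_of_eq ?_)
      push_cast
      have : (n : ℝ) + 1 ≠ 0 := by positivity
      field_simp
    exact pow_le_pow_left₀ (div_nonneg (cg_nonneg _ _ _) (by positivity)) h2 2

/-! ### Part E: asymptotics of the mixing time -/

lemma Th_term_le {s : ℝ} (hs : 0 < s) (m : Fin 3 → ℤ) :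
    (if m = 0 then 0 else Real.exp (-(s * aa m)))
      ≤ 2 * ((s * (Real.pi ^ 2 / 3))⁻¹) ^ 2 * ((qq m)⁻¹) ^ 2 := by
  split_ifs with h
  · positivity
  · refine (exp_neg_le (mul_pos hs (aa_pos h))).trans (le_of_eq ?_)
    unfold aa
    rw [← mul_assoc, mul_inv (s * (Real.pi ^ 2 / 3)), mul_pow]; ring

lemma Th_term_nonneg (s : ℝ) (m : Fin 3 → ℤ) :
    0 ≤ (if m = 0 then 0 else Real.exp (-(s * aa m))) := by
  split_ifs <;> positivity

lemma Th_summable {s : ℝ} (hs : 0 < s) :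
    Summable fun m : Fin 3 → ℤ => if m = 0 then 0 else Real.exp (-(s * aa m)) :=
  Summable.of_nonneg_of_le (Th_term_nonneg s) (Th_term_le hs) (summable_qq.mul_left _)

/-- a nonzero frequency -/
def m1 : Fin 3 → ℤ := ![1, 0, 0]

lemma m1_ne : m1 ≠ 0 := by
  intro h
  have := congrFun h 0
  simp [m1] at this

lemma aa_m1 : aa m1 = Real.pi ^ 2 / 3 := by
  simp [aa, qq, m1, Fin.sum_univ_three]

lemma Th_strictAnti {s s' : ℝ} (hs : 0 < s) (h : s < s') : Th s' < Th s := by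
  unfold Th
  refine Summable.tsum_lt_tsum (i := m1) ?_ ?_ (Th_summable (hs.trans h)) (Th_summable hs)
  · intro m
    dsimp only
    split_ifs with hm
    · exact le_rfl
    · have := aa_pos hm
      apply Real.exp_le_exp.2
      nlinarith
  · rw [if_neg m1_ne, if_neg m1_ne]
    have := aa_pos m1_ne
    apply Real.exp_lt_exp.2
    nlinarith

lemma Th_small : 1 / 4 < Th (3 / Real.pi ^ 2) := by
  have hp := Real.pi_pos
  have h := (Th_summable (s := 3 / Real.pi ^ 2) (by positivity)).le_tsum m1
    (fun m _ => Th_term_nonneg _ m)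
  rw [if_neg m1_ne, aa_m1] at h
  have e : 3 / Real.pi ^ 2 * (Real.pi ^ 2 / 3) = 1 := by field_simp
  rw [e] at h
  refine lt_of_lt_of_le ?_ h
  rw [Real.exp_neg, one_div]
  have := Real.exp_one_lt_d9
  exact inv_strictAnti₀ (Real.exp_pos 1) (by linarith)

lemma Th_large : ∃ s : ℝ, 0 < s ∧ Th s ≤ 1 / 4 := by
  set C : ℝ := 2 * ((Real.pi ^ 2 / 3)⁻¹) ^ 2 * ∑' m : Fin 3 → ℤ, ((qq m)⁻¹) ^ 2 with hC
  have hp := Real.pi_pos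
  have hC0 : 0 ≤ C := mul_nonneg (by positivity) (tsum_nonneg fun m => by positivity)
  have hb : ∀ s : ℝ, 0 < s → Th s ≤ C * (s⁻¹) ^ 2 := by
    intro s hs
    have h := (Th_summable hs).tsum_le_tsum (Th_term_le hs) (summable_qq.mul_left _)
    rw [tsum_mul_left] at h
    refine h.trans (le_of_eq ?_)
    rw [hC, mul_inv]; ring
  refine ⟨4 * C + 1, by linarith, (hb _ (by linarith)).trans ?_⟩
  have : C * ((4 * C + 1)⁻¹) ^ 2 = C / (4 * C + 1) ^ 2 := by rw [inv_pow]; rfl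
  rw [this, div_le_iff₀ (by positivity)]
  nlinarith

lemma exists_sstar : ∃ s₀ : ℝ, 0 < s₀ ∧ (∀ s, 0 < s → s < s₀ → 1 / 4 < Th s)
    ∧ (∀ s, s₀ < s → Th s < 1 / 4) := by
  set A : Set ℝ := {s | 0 < s ∧ Th s ≤ 1 / 4} with hA
  have hne : A.Nonempty := Th_large
  have hp := Real.pi_pos
  have hlow : ∀ s ∈ A, 3 / Real.pi ^ 2 ≤ s := by
    rintro s ⟨hs, h⟩
    by_contra hlt
    push Not at hlt
    have := Th_strictAnti hs hlt
    have := Th_small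
    linarith
  have hbdd : BddBelow A := ⟨_, hlow⟩
  refine ⟨sInf A, lt_of_lt_of_le (by positivity) (le_csInf hne hlow), ?_, ?_⟩
  · intro s hs hlt
    by_contra hh
    push Not at hh
    have := csInf_le hbdd (show s ∈ A from ⟨hs, hh⟩)
    linarith
  · intro s hlt
    obtain ⟨a, ⟨ha0, ha⟩, has⟩ := exists_lt_of_csInf_lt hne hlt
    exact (Th_strictAnti ha0 has).trans_le ha

lemma floor_lim (a : ℝ) (ha : 0 ≤ a) (u : ℕ → ℝ) (hu : Tendsto u atTop atTop) :
    Tendsto (fun n : ℕ => (⌊a * u n⌋₊ : ℝ) / u n) atTop (nhds a) :=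
  (tendsto_nat_floor_mul_div_atTop ha).comp hu

lemma Tmix_lim : ∃ s₀ : ℝ, 0 < s₀ ∧
    Tendsto (fun n : ℕ => (Tmix (torus 3 (n + 1)) : ℝ) / ((n : ℝ) + 1) ^ 2) atTop (nhds s₀) ∧
    ∀ᶠ n : ℕ in atTop, Dn (n + 1) (Tmix (torus 3 (n + 1))) ≤ 1 / 4 := by
  obtain ⟨s₀, hs0, hlo, hhi⟩ := exists_sstar
  have hfl : ∀ a : ℝ, 0 ≤ a → Tendsto (fun n : ℕ => (⌊a * ((n : ℝ) + 1) ^ 2⌋₊ : ℝ)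
      / ((n : ℝ) + 1) ^ 2) atTop (nhds a) := fun a ha => floor_lim a ha _ sq_atTop
  have hev3 : ∀ᶠ n : ℕ in atTop, 3 ≤ n + 1 := by
    filter_upwards [eventually_ge_atTop 2] with n hn
    omega
  have hup : ∀ b, s₀ < b → ∀ᶠ n : ℕ in atTop,
      Dn (n + 1) ⌊b * ((n : ℝ) + 1) ^ 2⌋₊ ≤ 1 / 4 := by
    intro b hb
    filter_upwards [(Dn_lim _ b (hs0.trans hb) (hfl b (hs0.trans hb).le)).eventually
      (gt_mem_nhds (hhi b hb))] with n hn using hn.le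
  have hmem : ∀ᶠ n : ℕ in atTop, Dn (n + 1) (Tmix (torus 3 (n + 1))) ≤ 1 / 4 := by
    filter_upwards [hup (s₀ + 1) (by linarith), hev3] with n hn h3
    rw [Tmix_eq h3]
    exact Nat.sInf_mem (s := {t : ℕ | Dn (n + 1) t ≤ 1 / 4}) ⟨_, hn⟩
  refine ⟨s₀, hs0, ?_, hmem⟩
  rw [tendsto_order]
  constructor
  · intro a ha
    obtain ⟨a', ha1, ha2⟩ := exists_between (max_lt ha hs0)
    have ha0 : 0 < a' := (le_max_right _ _).trans_lt ha1
    have haa : a < a' := (le_max_left _ _).trans_lt ha1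
    filter_upwards [(Dn_lim _ a' ha0 (hfl a' ha0.le)).eventually (lt_mem_nhds (hlo a' ha0 ha2)),
      (hfl a' ha0.le).eventually (lt_mem_nhds haa), hmem] with n h1 h2 h3
    refine h2.trans_le ?_
    gcongr
    by_contra hlt
    push Not at hlt
    have := Dn_anti (n + 1) hlt.le
    linarith
  · intro b hb
    obtain ⟨b', hb1, hb2⟩ := exists_between hb
    filter_upwards [hup b' hb1, hev3] with n h1 h3
    have h4 : Tmix (torus 3 (n + 1)) ≤ ⌊b' * ((n : ℝ) + 1) ^ 2⌋₊ := by
      rw [Tmix_eq h3]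
      exact Nat.sInf_le h1
    have hpos : (0 : ℝ) < ((n : ℝ) + 1) ^ 2 := by positivity
    have h5 : (Tmix (torus 3 (n + 1)) : ℝ) ≤ b' * ((n : ℝ) + 1) ^ 2 :=
      (Nat.cast_le.2 h4).trans (Nat.floor_le (mul_nonneg (hs0.trans hb1).le hpos.le))
    refine lt_of_le_of_lt ?_ hb2
    rwa [div_le_iff₀ hpos]

/-! ### Part F: the Green function on the diagonal -/

/-- integer steps -/
def stZ (p : Fin 3 × Bool) : Fin 3 → ℤ := if p.2 then Pi.single p.1 1 else - Pi.single p.1 1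

/-- heat kernel on the integer lattice -/
def Zp : ℕ → (Fin 3 → ℤ) → ℝ
  | 0 => fun m => if m = 0 then 1 else 0
  | t + 1 => fun m => 1 / 2 * Zp t m + 1 / 12 * ∑ p, Zp t (m + stZ p)

/-- reduction -/
def red (n : ℕ) (m : Fin 3 → ℤ) : Fin 3 → ZMod n := fun i => (m i : ZMod n)

lemma red_st (n : ℕ) (m : Fin 3 → ℤ) (p : Fin 3 × Bool) :
    red n m + st n p = red n (m + stZ p) := by
  obtain ⟨i, b⟩ := p
  funext j
  cases b <;> by_cases h : j = i <;> simp [red, st, stZ, Pi.single_apply, h]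

lemma stZ_le (p : Fin 3 × Bool) (i : Fin 3) : |stZ p i| ≤ 1 := by
  obtain ⟨j, b⟩ := p
  cases b <;> by_cases h : i = j <;> simp [stZ, Pi.single_apply, h]

lemma Kpow_eq_Zp {n : ℕ} [NeZero n] (hn : 3 ≤ n) (t : ℕ) (m : Fin 3 → ℤ)
    (hm : ∀ i, |m i| + t < n) : Kpow (torus 3 n) t (red n m) 0 = Zp t m := by
  induction t generalizing m with
  | zero =>
    have : red n m = 0 ↔ m = 0 := by
      constructor
      · intro h
        funext i
        have h1 := congrFun h i
        simp only [red, Pi.zero_apply] at h1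
        rw [ZMod.intCast_zmod_eq_zero_iff_dvd] at h1
        have h2 := hm i
        exact Int.eq_zero_of_abs_lt_dvd h1 (by simpa using h2)
      · rintro rfl; funext i; simp [red]
    simp only [Kpow, Zp, this]
  | succ t ih =>
    rw [Kpow_step hn, Zp, ih m (fun i => by have := hm i; push_cast at this; omega)]
    congr 2
    refine Finset.sum_congr rfl fun p _ => ?_
    rw [red_st, ih]
    intro i
    have h1 := hm i
    have h2 := stZ_le p i
    have h3 := abs_add_le (m i) (stZ p i)
    simp only [Pi.add_apply]
    push_cast at h1
    omega

lemma geom_int_bound {b : ℝ} (hb : 0 < b) (s : Finset ℤ) :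
    ∑ v ∈ s, Real.exp (-(b * |(v : ℝ)|)) ≤ 2 * (1 + 1 / b) := by
  set r := Real.exp (-b) with hr
  have hr0 : 0 < r := Real.exp_pos _
  have hr1 : r < 1 := by rw [hr, Real.exp_lt_one_iff]; linarith
  have h1 : HasSum (fun l : ℕ => Real.exp (-(b * |((l : ℤ) : ℝ)|))) ((1 - r)⁻¹) := by
    refine (hasSum_geometric_of_lt_one hr0.le hr1).congr_fun ?_
    intro l
    rw [hr, ← Real.exp_nat_mul]; congr 1
    rw [Int.cast_natCast, abs_of_nonneg (by positivity)]; ring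
  have h2 : HasSum (fun l : ℕ => Real.exp (-(b * |((-((l : ℤ) + 1) : ℤ) : ℝ)|))) ((1 - r)⁻¹ * r) := by
    refine ((hasSum_geometric_of_lt_one hr0.le hr1).mul_right r).congr_fun ?_
    intro l
    rw [hr, ← Real.exp_nat_mul, ← Real.exp_add]; congr 1
    push_cast
    rw [abs_neg, abs_of_nonneg (by positivity)]; ring
  have h3 := HasSum.of_nat_of_neg_add_one (f := fun v : ℤ => Real.exp (-(b * |(v : ℝ)|))) h1 h2
  refine (sum_le_hasSum s (fun v _ => (Real.exp_pos _).le) h3).trans ?_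
  have h4 : (1 - r)⁻¹ ≤ 1 + 1 / b := by
    have : r ≤ (1 + b)⁻¹ := by
      rw [hr, Real.exp_neg]
      exact inv_anti₀ (by linarith) (by have := Real.add_one_le_exp b; linarith)
    have h5 : b / (1 + b) ≤ 1 - r := by
      have : b / (1 + b) = 1 - (1 + b)⁻¹ := by field_simp; ring
      linarith
    calc (1 - r)⁻¹ ≤ (b / (1 + b))⁻¹ := inv_anti₀ (by positivity) h5
      _ = 1 + 1 / b := by field_simp; ring
  have h6 : 0 < (1 - r)⁻¹ := inv_pos.2 (by linarith)
  nlinarith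

lemma diag_bound {n : ℕ} [NeZero n] {t : ℕ} (ht : 1 ≤ t) :
    ((n : ℝ) ^ 3)⁻¹ * ∑ k : Fin 3 → ZMod n, Lam n (lift3 k) ^ t
      ≤ (2 * Real.exp (1 / 4) * (1 / n + 1 / Real.sqrt t)) ^ 3 := by
  have hn : (0 : ℝ) < n := by exact_mod_cast Nat.pos_of_ne_zero (NeZero.ne n)
  have ht0 : (0 : ℝ) < t := by exact_mod_cast ht
  have hst : 0 < Real.sqrt t := Real.sqrt_pos.2 ht0
  set b := Real.sqrt t / n with hb
  have hb0 : 0 < b := div_pos hst hn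
  have hb2 : b ^ 2 = t / n ^ 2 := by rw [hb, div_pow, Real.sq_sqrt ht0.le]
  set f : ZMod n → ℝ := fun j => Real.exp (1 / 4) * Real.exp (-(b * |((j.valMinAbs : ℤ) : ℝ)|))
    with hf
  have h1 : ∀ k : Fin 3 → ZMod n, Lam n (lift3 k) ^ t ≤ ∏ i, f (k i) := by
    intro k
    refine (Lam_pow_le k t).trans ?_
    rw [← hb2]
    simp only [hf, ← Real.exp_add]
    rw [← Real.exp_sum]
    apply Real.exp_le_exp.2
    unfold qq lift3
    rw [Finset.mul_sum, ← Finset.sum_neg_distrib]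
    refine Finset.sum_le_sum fun i _ => ?_
    rw [← sq_abs (((k i).valMinAbs : ℤ) : ℝ)]
    nlinarith [sq_nonneg (b * |(((k i).valMinAbs : ℤ) : ℝ)| - 1 / 2),
      sq_nonneg (b * |(((k i).valMinAbs : ℤ) : ℝ)|)]
  have h2 : ∑ j, f j ≤ Real.exp (1 / 4) * (2 * (1 + 1 / b)) := by
    simp only [hf]
    rw [← Finset.mul_sum]
    gcongr
    have := geom_int_bound hb0 (Finset.univ.image (ZMod.valMinAbs : ZMod n → ℤ))
    rwa [Finset.sum_image (fun a _ b _ h => ZMod.injective_valMinAbs h)] at this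
  have hf0 : 0 ≤ ∑ j, f j := Finset.sum_nonneg fun j _ => by positivity
  calc _ ≤ ((n : ℝ) ^ 3)⁻¹ * ∑ k : Fin 3 → ZMod n, ∏ i, f (k i) := by
        gcongr with k _
        exact h1 k
    _ = ((n : ℝ) ^ 3)⁻¹ * (∑ j, f j) ^ 3 := by
        rw [Fintype.sum_pow]
    _ ≤ ((n : ℝ) ^ 3)⁻¹ * (Real.exp (1 / 4) * (2 * (1 + 1 / b))) ^ 3 := by gcongr
    _ = _ := by
        rw [hb]
        field_simp

lemma gr_diag {n : ℕ} [NeZero n] (hn : 3 ≤ n) (T : ℕ) (x : Fin 3 → ZMod n) :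
    gr (torus 3 n) T x x = gr (torus 3 n) T 0 0 := by
  unfold gr
  exact Finset.sum_congr rfl fun t _ => by rw [Kpow_diag hn, Kpow_diag hn]

lemma one_le_gr (n : ℕ) [NeZero n] (T : ℕ) (x : Fin 3 → ZMod n) :
    1 ≤ gr (torus 3 n) T x x := by
  have h := gr_mono (torus 3 n) (Nat.zero_le T) x x
  simpa [gr, Kpow] using h

lemma gr_lim : ∃ g : ℝ, 1 ≤ g ∧ ∀ (T : ℕ → ℕ) (M : ℝ), 0 ≤ M → Tendsto T atTop atTop →
    (∀ᶠ n : ℕ in atTop, (T n : ℝ) ≤ M * ((n : ℝ) + 1) ^ 2) →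
    Tendsto (fun n : ℕ => gr (torus 3 (n + 1)) (T n) 0 0) atTop (nhds g) := by
  have main : ∀ (T : ℕ → ℕ) (M : ℝ), 0 ≤ M → Tendsto T atTop atTop →
    (∀ᶠ n : ℕ in atTop, (T n : ℝ) ≤ M * ((n : ℝ) + 1) ^ 2) →
    Tendsto (fun n : ℕ => gr (torus 3 (n + 1)) (T n) 0 0) atTop (nhds (∑' t, Zp t 0)) := by
    intro T M hM hT hb
    set H : ℕ → ℕ → ℝ := fun n t => if t ≤ T n then Kpow (torus 3 (n + 1)) t 0 0 else 0 with hH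
    have e : ∀ n : ℕ, gr (torus 3 (n + 1)) (T n) 0 0 = ∑' t, H n t := by
      intro n
      rw [tsum_eq_sum (s := Finset.range (T n + 1))]
      · unfold gr
        refine Finset.sum_congr rfl fun t ht => ?_
        simp only [hH]
        rw [if_pos (by simpa [Nat.lt_succ_iff] using ht)]
      · intro t ht
        simp only [hH]
        rw [if_neg (by simpa [Nat.lt_succ_iff] using ht)]
    simp_rw [e]
    set D : ℝ := 2 * Real.exp (1 / 4) * (Real.sqrt M + 1) with hD
    have hD0 : 0 ≤ D := by positivity
    refine tendsto_tsum_of_dominated_convergence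
      (bound := fun t : ℕ => D ^ 3 * (1 / (t : ℝ) ^ (3 / 2 : ℝ)) + if t = 0 then 1 else 0) ?_ ?_ ?_
    · refine ((Real.summable_one_div_nat_rpow.2 (by norm_num)).mul_left _).add ?_
      exact summable_of_ne_finset_zero (s := {0}) (fun j hj => by rw [if_neg (by simpa using hj)])
    · intro t
      refine tendsto_const_nhds.congr' ?_
      filter_upwards [hT.eventually_ge_atTop t, eventually_ge_atTop (t + 2)] with n h1 h2
      simp only [hH]
      rw [if_pos h1]
      have := Kpow_eq_Zp (n := n + 1) (by omega) t 0 (by intro i; simp; omega)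
      rw [← this]
      congr 1
    · filter_upwards [hb, eventually_ge_atTop 2] with n hn h2 t
      simp only [hH]
      by_cases ht : t ≤ T n
      · rw [if_pos ht, Real.norm_of_nonneg (Kpow_nonneg _ _ _ _)]
        by_cases h0 : t = 0
        · subst h0
          simp [Kpow]
        · rw [if_neg h0, add_zero, Kpow_diag (by omega)]
          have ht1 : 1 ≤ t := Nat.one_le_iff_ne_zero.2 h0
          have htp : (0 : ℝ) < t := by exact_mod_cast ht1
          refine (diag_bound ht1).trans ?_
          have hst : 0 < Real.sqrt t := Real.sqrt_pos.2 htp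
          have hN : (0 : ℝ) < (n : ℝ) + 1 := by positivity
          have h3 : 1 / (((n + 1 : ℕ) : ℝ)) ≤ Real.sqrt M / Real.sqrt t := by
            rw [div_le_div_iff₀ (by positivity) hst, one_mul]
            have : Real.sqrt t ≤ Real.sqrt (M * ((n : ℝ) + 1) ^ 2) :=
              Real.sqrt_le_sqrt (le_trans (by exact_mod_cast ht) hn)
            rw [Real.sqrt_mul hM, Real.sqrt_sq hN.le] at this
            push_cast
            exact this
          calc (2 * Real.exp (1 / 4) * (1 / (((n + 1 : ℕ) : ℝ)) + 1 / Real.sqrt t)) ^ 3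
              ≤ (2 * Real.exp (1 / 4) * (Real.sqrt M / Real.sqrt t + 1 / Real.sqrt t)) ^ 3 := by
                gcongr
            _ = D ^ 3 * (1 / (Real.sqrt t) ^ 3) := by rw [hD]; field_simp
            _ = _ := by
                have h7 : Real.sqrt t ^ 3 = (t : ℝ) ^ (3 / 2 : ℝ) := by
                  rw [Real.sqrt_eq_rpow, ← Real.rpow_natCast, ← Real.rpow_mul htp.le]
                  norm_num
                rw [h7]
      · rw [if_neg ht, norm_zero]
        have : (0 : ℝ) ≤ if t = 0 then 1 else 0 := by split_ifs <;> norm_num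
        positivity
  refine ⟨∑' t, Zp t 0, ?_, main⟩
  have h := main (fun n => n) 1 zero_le_one tendsto_id (Eventually.of_forall fun n => by
    nlinarith [(Nat.cast_nonneg n : (0 : ℝ) ≤ n)])
  exact ge_of_tendsto' h fun n => one_le_gr _ _ _

/-! ### Part G: assembly -/

lemma Wlim_pos {s : ℝ} (hs : 0 < s) : 0 < Wlim s := by
  have hp := Real.pi_pos
  have h0 : ∀ m : Fin 3 → ℤ,
      0 ≤ (if m = 0 then 0 else ((1 - Real.exp (-(s * aa m))) / aa m) ^ 2) := by
    intro m; split_ifs <;> positivity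
  have hsum : Summable fun m : Fin 3 → ℤ =>
      if m = 0 then 0 else ((1 - Real.exp (-(s * aa m))) / aa m) ^ 2 := by
    refine Summable.of_nonneg_of_le h0 ?_ (summable_qq.mul_left (((Real.pi ^ 2 / 3)⁻¹) ^ 2))
    intro m
    split_ifs with h
    · positivity
    · have ha := aa_pos h
      have h1 : Real.exp (-(s * aa m)) ≤ 1 := Real.exp_le_one_iff.2 (by nlinarith)
      have h2 := Real.exp_pos (-(s * aa m))
      have h3 : (1 - Real.exp (-(s * aa m))) / aa m ≤ 1 / aa m := by gcongr; linarith
      have h4 : 0 ≤ (1 - Real.exp (-(s * aa m))) / aa m := div_nonneg (by linarith) ha.le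
      refine (pow_le_pow_left₀ h4 h3 2).trans (le_of_eq ?_)
      unfold aa
      rw [one_div, mul_inv, mul_pow]
  refine hsum.tsum_pos h0 m1 ?_
  rw [if_neg m1_ne]
  have ha := aa_pos m1_ne
  have : Real.exp (-(s * aa m1)) < 1 := by
    rw [Real.exp_lt_one_iff]; nlinarith
  exact pow_pos (div_pos (by linarith) ha) 2

lemma var_cmp {ι : Type*} [Fintype ι] (u v : ι → ℝ) (μ M : ℝ) (hM : (Fintype.card ι : ℝ) = M)
    (hM0 : 0 < M) (hv : ∑ i, (v i - μ) = 0) :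
    |∑ i, (u i - (∑ j, u j) / M) ^ 2 - ∑ i, (v i - μ) ^ 2|
      ≤ 2 * Real.sqrt ((∑ i, (v i - μ) ^ 2) * ∑ i, (u i - v i) ^ 2) + ∑ i, (u i - v i) ^ 2 := by
  set W := ∑ i, (v i - μ) ^ 2 with hW
  set E := ∑ i, (u i - v i) ^ 2 with hE
  set C := ∑ i, (v i - μ) * (u i - v i) with hC
  set e := ∑ i, (u i - v i) with he
  have hCS : C ^ 2 ≤ W * E := Finset.sum_mul_sq_le_sq_mul_sq _ _ _
  have hes : e ^ 2 ≤ M * E := by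
    have := Finset.sum_mul_sq_le_sq_mul_sq Finset.univ (fun _ : ι => (1 : ℝ)) (fun i => u i - v i)
    simp only [one_mul, one_pow, Finset.sum_const, Finset.card_univ, nsmul_eq_mul, mul_one] at this
    rwa [hM] at this
  have hu : ∑ j, u j = e + M * μ := by
    have : ∑ j, u j = ∑ j, ((u j - v j) + (v j - μ) + μ) :=
      Finset.sum_congr rfl fun j _ => by ring
    rw [this, Finset.sum_add_distrib, Finset.sum_add_distrib, hv]
    simp [hM, he]
  have hd : (∑ j, u j) / M = μ + e / M := by rw [hu]; field_simp; ring
  have key : ∑ i, (u i - (∑ j, u j) / M) ^ 2 = W + 2 * C + E - e ^ 2 / M := by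
    have h1 : ∀ i, (u i - (∑ j, u j) / M) ^ 2 = (v i - μ) ^ 2 + 2 * ((v i - μ) * (u i - v i))
        + (u i - v i) ^ 2 - 2 * (e / M) * (u i - v i) - 2 * (e / M) * (v i - μ) + (e / M) ^ 2 := by
      intro i; rw [hd]; ring
    simp_rw [h1]
    rw [Finset.sum_add_distrib, Finset.sum_sub_distrib, Finset.sum_sub_distrib,
      Finset.sum_add_distrib, Finset.sum_add_distrib, ← Finset.mul_sum, ← Finset.mul_sum,
      ← Finset.mul_sum, hv]
    simp only [Finset.sum_const, Finset.card_univ, nsmul_eq_mul]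
    rw [hM]
    field_simp
    ring
  have hC2 : |C| ≤ Real.sqrt (W * E) := Real.abs_le_sqrt hCS
  have hq : e ^ 2 / M ≤ E := by rw [div_le_iff₀ hM0]; linarith
  have hq0 : 0 ≤ e ^ 2 / M := by positivity
  have hE0 : 0 ≤ E := Finset.sum_nonneg fun i _ => sq_nonneg _
  rw [key, abs_le]
  obtain ⟨h1, h2⟩ := abs_le.1 hC2
  constructor <;> linarith

lemma gr_sum {n : ℕ} [NeZero n] (hn : 3 ≤ n) (T : ℕ) :
    ∑ x, ∑ y, (gr (torus 3 n) T x y - ((T : ℝ) + 1) / (n : ℝ) ^ 3) = 0 := by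
  have h1 := gr_sq_sum hn T
  have h2 := gr_var_sum hn T
  have hn0 : (0 : ℝ) < n := by exact_mod_cast Nat.pos_of_ne_zero (NeZero.ne n)
  set m := ((T : ℝ) + 1) / (n : ℝ) ^ 3 with hm
  have hm0 : 0 < m := by positivity
  have hmn : (n : ℝ) ^ 3 * m = (T : ℝ) + 1 := by rw [hm]; field_simp
  have e1 : ∀ x y, (gr (torus 3 n) T x y - m) ^ 2
      = gr (torus 3 n) T x y ^ 2 - 2 * m * (gr (torus 3 n) T x y - m) - m ^ 2 := by
    intro x y; ring
  simp_rw [e1, Finset.sum_sub_distrib, ← Finset.mul_sum] at h2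
  simp only [Finset.sum_const, Finset.card_univ, nsmul_eq_mul, card_V] at h2
  rw [h1] at h2
  set S := ∑ x, ∑ y, (gr (torus 3 n) T x y - m)
  have h3 : 2 * m * S = 0 := by
    have : ((T : ℝ) + 1) ^ 2 = (n : ℝ) ^ 3 * ((n : ℝ) ^ 3 * m ^ 2) := by rw [← hmn]; ring
    linarith
  rcases mul_eq_zero.1 h3 with h | h
  · linarith
  · exact h

lemma gr_incr {n : ℕ} [NeZero n] (hn : 3 ≤ n) (T S : ℕ) (hD : Dn n T ≤ 1 / 4)
    (x y : Fin 3 → ZMod n) :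
    gr (torus 3 n) (T + S) x y - gr (torus 3 n) T x y ≤ 5 / 4 * S / (n : ℝ) ^ 3 := by
  have hn0 : (0 : ℝ) < n := by exact_mod_cast Nat.pos_of_ne_zero (NeZero.ne n)
  induction S with
  | zero => simp
  | succ S ih =>
    have h1 : gr (torus 3 n) (T + (S + 1)) x y
        = gr (torus 3 n) (T + S) x y + Kpow (torus 3 n) (T + S + 1) x y := by
      unfold gr
      rw [← Finset.sum_range_succ]
      rfl
    have h2 := Kpow_le_diag hn (T + S + 1) x y
    rw [sum_eq_Dn] at h2
    have h3 : Dn n (T + S + 1) ≤ 1 / 4 := (Dn_anti n (by omega)).trans hD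
    have h4 : ((n : ℝ) ^ 3)⁻¹ * (1 + Dn n (T + S + 1)) ≤ ((n : ℝ) ^ 3)⁻¹ * (5 / 4) := by
      gcongr; linarith
    have h5 : 5 / 4 * ((S + 1 : ℕ) : ℝ) / (n : ℝ) ^ 3
        = 5 / 4 * S / (n : ℝ) ^ 3 + ((n : ℝ) ^ 3)⁻¹ * (5 / 4) := by
      push_cast; field_simp
    rw [h1, h5]
    linarith

lemma err_bound {n : ℕ} [NeZero n] (hn : 3 ≤ n) (T S : ℕ) (hD : Dn n T ≤ 1 / 4) :
    ∑ p : (Fin 3 → ZMod n) × (Fin 3 → ZMod n),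
      (hitBy (torus 3 n) {p.2} p.1 T - gr (torus 3 n) T p.1 p.2 / gr (torus 3 n) T 0 0) ^ 2
      ≤ 2 * (5 / 4) ^ 2 * (S : ℝ) ^ 2
        + 2 * ((gr (torus 3 n) S 0 0)⁻¹ - (gr (torus 3 n) T 0 0)⁻¹) ^ 2
          * (((T : ℝ) + 1) ^ 2 + Wn n T) := by
  have hn0 : (0 : ℝ) < n := by exact_mod_cast Nat.pos_of_ne_zero (NeZero.ne n)
  have hK := torus_K_row (n := n) hn
  have hT1 := one_le_gr n T 0
  have hS1 := one_le_gr n S 0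
  set gT := gr (torus 3 n) T 0 0 with hgT
  set gS := gr (torus 3 n) S 0 0 with hgS
  have hpt : ∀ p : (Fin 3 → ZMod n) × (Fin 3 → ZMod n),
      (hitBy (torus 3 n) {p.2} p.1 T - gr (torus 3 n) T p.1 p.2 / gT) ^ 2
      ≤ 2 * (5 / 4 * S / (n : ℝ) ^ 3) ^ 2
        + 2 * (gS⁻¹ - gT⁻¹) ^ 2 * gr (torus 3 n) T p.1 p.2 ^ 2 := by
    rintro ⟨x, y⟩
    simp only
    have h1 := gr_le_hit (torus 3 n) hK T x y
    have h2 := hit_le_gr (torus 3 n) hK T S x y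
    rw [gr_diag hn, ← hgT] at h1
    rw [gr_diag hn, ← hgS] at h2
    have h3 := gr_incr hn T S hD x y
    set u := hitBy (torus 3 n) {y} x T
    set a := gr (torus 3 n) T x y
    set b := gr (torus 3 n) (T + S) x y
    set d := 5 / 4 * (S : ℝ) / (n : ℝ) ^ 3 with hd
    have hd0 : 0 ≤ d := by positivity
    have e0 : 0 ≤ u - a / gT := by
      rw [sub_nonneg, div_le_iff₀ (by linarith)]; exact h1
    have e1 : u ≤ b / gS := by rw [le_div_iff₀ (by linarith)]; exact h2
    have e2 : b / gS ≤ (a + d) / gS := by gcongr; linarith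
    have e3 : (a + d) / gS = a * gS⁻¹ + d / gS := by rw [add_div]; rfl
    have e4 : d / gS ≤ d := div_le_self hd0 hS1
    have e5 : u - a / gT ≤ d + (gS⁻¹ - gT⁻¹) * a := by
      rw [div_eq_mul_inv a gT]; linarith
    calc (u - a / gT) ^ 2 ≤ (d + (gS⁻¹ - gT⁻¹) * a) ^ 2 := pow_le_pow_left₀ e0 e5 2
      _ ≤ _ := by nlinarith [sq_nonneg (d - (gS⁻¹ - gT⁻¹) * a)]
  refine (Finset.sum_le_sum fun p _ => hpt p).trans (le_of_eq ?_)
  have h9 : ∑ p : (Fin 3 → ZMod n) × (Fin 3 → ZMod n), gr (torus 3 n) T p.1 p.2 ^ 2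
      = ((T : ℝ) + 1) ^ 2 + Wn n T := by
    rw [Fintype.sum_prod_type, gr_sq_sum hn T]
  rw [Finset.sum_add_distrib, ← Finset.mul_sum Finset.univ
    (fun p : (Fin 3 → ZMod n) × (Fin 3 → ZMod n) => gr (torus 3 n) T p.1 p.2 ^ 2), h9]
  congr 1
  simp only [Finset.sum_const, Finset.card_univ, nsmul_eq_mul, Fintype.card_prod, Nat.cast_mul,
    card_V]
  field_simp

lemma Fquad_cmp {n : ℕ} [NeZero n] (hn : 3 ≤ n) (c : ℝ) (T : ℕ)
    (hT : T = ⌊c * (Tmix (torus 3 n) : ℝ)⌋₊) (B : ℝ)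
    (hB : ∑ p : (Fin 3 → ZMod n) × (Fin 3 → ZMod n),
      (hitBy (torus 3 n) {p.2} p.1 T - gr (torus 3 n) T p.1 p.2 / gr (torus 3 n) T 0 0) ^ 2 ≤ B) :
    |Fquad (torus 3 n) c - Wn n T / gr (torus 3 n) T 0 0 ^ 2|
      ≤ 2 * Real.sqrt (Wn n T / gr (torus 3 n) T 0 0 ^ 2 * B) + B := by
  have hn0 : (0 : ℝ) < n := by exact_mod_cast Nat.pos_of_ne_zero (NeZero.ne n)
  have hT1 := one_le_gr n T 0
  set gT := gr (torus 3 n) T 0 0 with hgT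
  have hg0 : 0 < gT := by linarith
  set m := ((T : ℝ) + 1) / (n : ℝ) ^ 3 with hm
  have hW : ∑ p : (Fin 3 → ZMod n) × (Fin 3 → ZMod n),
      (gr (torus 3 n) T p.1 p.2 / gT - m / gT) ^ 2 = Wn n T / gT ^ 2 := by
    simp_rw [← sub_div, div_pow]
    rw [← Finset.sum_div, Fintype.sum_prod_type, gr_var_sum hn T]
  have h := var_cmp (fun p : (Fin 3 → ZMod n) × (Fin 3 → ZMod n) => hitBy (torus 3 n) {p.2} p.1 T)
    (fun p => gr (torus 3 n) T p.1 p.2 / gT) (m / gT) (((n : ℝ) ^ 3) ^ 2)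
    (by rw [Fintype.card_prod, Nat.cast_mul, card_V, sq]) (by positivity)
    (by simp_rw [← sub_div]; rw [← Finset.sum_div, Fintype.sum_prod_type, gr_sum hn T, zero_div])
  rw [hW] at h
  have hF : Fquad (torus 3 n) c = ∑ p : (Fin 3 → ZMod n) × (Fin 3 → ZMod n),
      (hitBy (torus 3 n) {p.2} p.1 T - (∑ q : (Fin 3 → ZMod n) × (Fin 3 → ZMod n),
        hitBy (torus 3 n) {q.2} q.1 T) / ((n : ℝ) ^ 3) ^ 2) ^ 2 := by
    unfold Fquad fbar fnc
    rw [← hT, card_V, Fintype.sum_prod_type, Fintype.sum_prod_type]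
  rw [hF]
  have hWn : 0 ≤ Wn n T / gT ^ 2 := by rw [← hW]; positivity
  refine h.trans ?_
  gcongr

theorem final (c : ℝ) (hc : 1 < c) : ∃ L : ℝ, 0 < L ∧
    Tendsto (fun n : ℕ => Fquad (torus 3 (n + 1)) c / ((n + 1 : ℝ)) ^ 4) atTop (nhds L) := by
  obtain ⟨s₀, hs0, hmix, hmem⟩ := Tmix_lim
  obtain ⟨g, hg1, hg⟩ := gr_lim
  set T : ℕ → ℕ := fun n => ⌊c * (Tmix (torus 3 (n + 1)) : ℝ)⌋₊ with hT
  have hsq : ∀ n : ℕ, (0 : ℝ) < ((n : ℝ) + 1) ^ 2 := fun n => by positivity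
  have hTm : Tendsto (fun n : ℕ => (Tmix (torus 3 (n + 1)) : ℝ)) atTop atTop := by
    refine (hmix.pos_mul_atTop hs0 sq_atTop).congr fun n => ?_
    rw [div_mul_cancel₀ _ (hsq n).ne']
  have hTlim : Tendsto (fun n : ℕ => (T n : ℝ) / ((n : ℝ) + 1) ^ 2) atTop (nhds (c * s₀)) := by
    refine ((floor_lim c (by linarith) _ hTm).mul hmix).congr' ?_
    filter_upwards [hTm.eventually_gt_atTop 0] with n hn
    simp only [hT]
    rw [div_mul_div_cancel₀ hn.ne']
  have hcs : 0 < c * s₀ := mul_pos (by linarith) hs0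
  have hTtop : Tendsto T atTop atTop := by
    rw [← tendsto_natCast_atTop_iff (R := ℝ)]
    refine (hTlim.pos_mul_atTop hcs sq_atTop).congr fun n => ?_
    rw [div_mul_cancel₀ _ (hsq n).ne']
  have hgT : Tendsto (fun n : ℕ => gr (torus 3 (n + 1)) (T n) 0 0) atTop (nhds g) := by
    refine hg T (c * s₀ + 1) (by linarith) hTtop ?_
    filter_upwards [hTlim.eventually (gt_mem_nhds (lt_add_one (c * s₀)))] with n hn
    exact ((div_lt_iff₀ (hsq n)).1 hn).le
  have hgS : Tendsto (fun n : ℕ => gr (torus 3 (n + 1)) n 0 0) atTop (nhds g) :=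
    hg (fun n => n) 1 zero_le_one tendsto_id (Eventually.of_forall fun n => by
      nlinarith [(Nat.cast_nonneg n : (0 : ℝ) ≤ n)])
  have hg0 : g ≠ 0 := by linarith
  have hW := Wn_lim T (c * s₀) hTlim
  have hWg : Tendsto (fun n : ℕ => Wn (n + 1) (T n) / gr (torus 3 (n + 1)) (T n) 0 0 ^ 2
      / ((n : ℝ) + 1) ^ 4) atTop (nhds (Wlim (c * s₀) / g ^ 2)) := by
    refine (hW.div (hgT.pow 2) (pow_ne_zero 2 hg0)).congr fun n => ?_
    rw [div_right_comm]
    rfl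
  set Bn : ℕ → ℝ := fun n => 2 * (5 / 4) ^ 2 * (n : ℝ) ^ 2
        + 2 * ((gr (torus 3 (n + 1)) n 0 0)⁻¹ - (gr (torus 3 (n + 1)) (T n) 0 0)⁻¹) ^ 2
          * (((T n : ℝ) + 1) ^ 2 + Wn (n + 1) (T n)) with hBn
  have hB : Tendsto (fun n : ℕ => Bn n / ((n : ℝ) + 1) ^ 4) atTop (nhds 0) := by
    have a0 : Tendsto (fun n : ℕ => (1 : ℝ) / ((n : ℝ) + 1) ^ 2) atTop (nhds 0) :=
      sq_atTop.const_div_atTop 1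
    have a1 : Tendsto (fun n : ℕ => (n : ℝ) ^ 2 / ((n : ℝ) + 1) ^ 4) atTop (nhds 0) := by
      refine squeeze_zero (fun n => by positivity) (fun n => ?_) a0
      rw [div_le_div_iff₀ (by positivity) (by positivity)]
      have : (0 : ℝ) ≤ n := Nat.cast_nonneg n
      have h1 : (n : ℝ) ^ 2 ≤ ((n : ℝ) + 1) ^ 2 := by gcongr; linarith
      nlinarith [hsq n]
    have a2 : Tendsto (fun n : ℕ => (((T n : ℝ) + 1) ^ 2 + Wn (n + 1) (T n)) / ((n : ℝ) + 1) ^ 4)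
        atTop (nhds ((c * s₀ + 0) ^ 2 + Wlim (c * s₀))) := by
      refine (((hTlim.add a0).pow 2).add hW).congr fun n => ?_
      have := (hsq n).ne'
      rw [← add_div, div_pow, ← pow_mul, ← add_div]
    have a3 : Tendsto (fun n : ℕ => ((gr (torus 3 (n + 1)) n 0 0)⁻¹
        - (gr (torus 3 (n + 1)) (T n) 0 0)⁻¹) ^ 2) atTop (nhds ((g⁻¹ - g⁻¹) ^ 2)) :=
      ((hgS.inv₀ hg0).sub (hgT.inv₀ hg0)).pow 2
    have := (a1.const_mul (2 * (5 / 4) ^ 2)).add ((a3.const_mul 2).mul a2)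
    rw [sub_self, zero_pow two_ne_zero, mul_zero, mul_zero, zero_mul, add_zero] at this
    refine this.congr fun n => ?_
    simp only [hBn]
    ring
  have hdiff : Tendsto (fun n : ℕ => Fquad (torus 3 (n + 1)) c / ((n + 1 : ℝ)) ^ 4
      - Wn (n + 1) (T n) / gr (torus 3 (n + 1)) (T n) 0 0 ^ 2 / ((n : ℝ) + 1) ^ 4)
      atTop (nhds 0) := by
    have hlim : Tendsto (fun n : ℕ => 2 * Real.sqrt (Wn (n + 1) (T n)
        / gr (torus 3 (n + 1)) (T n) 0 0 ^ 2 / ((n : ℝ) + 1) ^ 4 * (Bn n / ((n : ℝ) + 1) ^ 4))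
        + Bn n / ((n : ℝ) + 1) ^ 4) atTop (nhds 0) := by
      have := (((Real.continuous_sqrt.tendsto _).comp (hWg.mul hB)).const_mul 2).add hB
      simpa using this
    refine squeeze_zero_norm' ?_ hlim
    filter_upwards [hmem, eventually_ge_atTop 2] with n h1 h2
    have h3 : 3 ≤ n + 1 := by omega
    have h4 : Tmix (torus 3 (n + 1)) ≤ T n := by
      simp only [hT]
      apply Nat.le_floor
      have : (0 : ℝ) ≤ (Tmix (torus 3 (n + 1)) : ℝ) := Nat.cast_nonneg _
      nlinarith
    have h5 := (Dn_anti (n + 1) h4).trans h1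
    have h6 := Fquad_cmp h3 c (T n) rfl (Bn n) (err_bound h3 (T n) n h5)
    have hN : (0 : ℝ) < ((n : ℝ) + 1) ^ 4 := by positivity
    rw [← sub_div, Real.norm_eq_abs, abs_div, abs_of_pos hN, div_le_iff₀ hN]
    refine h6.trans (le_of_eq ?_)
    rw [add_mul, div_mul_cancel₀ _ hN.ne', mul_assoc, div_mul_div_comm,
      Real.sqrt_div' _ (by positivity), Real.sqrt_mul_self hN.le, div_mul_cancel₀ _ hN.ne']
  refine ⟨Wlim (c * s₀) / g ^ 2, div_pos (Wlim_pos hcs) (by positivity), ?_⟩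
  have := hdiff.add hWg
  rw [zero_add] at this
  exact this.congr fun n => by ring

/-- Proposition 4, `d = 3`. On the torus `ℤ_n³`, for each
`c > 1` the limit `lim_n (1/n⁴) ∑_{x,y} (f_{n,c}(x,y) - f̄_{n,c})²` exists and
is positive and finite. -/
theorem Fquad_limit_dim_three :
    ∀ c : ℝ, 1 < c →
      ∃ L : ℝ, 0 < L ∧
        Tendsto (fun n => Fquad (torus 3 (n + 1)) c / ((n + 1 : ℝ)) ^ 4)
          atTop (nhds L) := by
  intro c hc
  exact final c hc

end RWPaint
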